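/- Let n ∈ ℕ with n ≥ 1, let f be a polynomial of degree at most n, and for κ > 0 set μ(κ) := m({z ∈ ℂ : u_f(z) > κ}). Then the function κ ↦ κ^{−2/n} (1 − μ(κ)) is nondecreasing on (0, sup u_f). Moreover, if f ∈ M₂, then this function is constant on (0, sup u_f). -/

import Mathlib

open MeasureTheory

/-- `u_f(z) = |f(z)| (1+|z|²)^{−n/2}` for a polynomial `f`. -/
noncomputable def uPoly (n : ℕ) (f : Polynomial ℂ) (z : ℂ) : ℝ :=
  ‖f.eval z‖ * (1 + ‖z‖^2) ^ (-(n:ℝ)/2)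

/-- The optimizer set `M₂`: the polynomials whose values are
`e^{iθ} (1 + conj(w) z)^n / (1+|w|²)^{n/2}` or `e^{iθ} z^n`. -/
def polyOpt (n : ℕ) : Set (Polynomial ℂ) :=
  {f | ∃ θ : ℝ,
    (∃ w : ℂ, ∀ z : ℂ, f.eval z =
      Complex.exp (Complex.I * (θ:ℂ)) * (1 + (starRingEnd ℂ) w * z)^n /
        ((((1 + ‖w‖^2) ^ ((n:ℝ)/2) : ℝ)) : ℂ)) ∨
    (∀ z : ℂ, f.eval z = Complex.exp (Complex.I * (θ:ℂ)) * z^n)}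

/-- `μ(κ) = m({u_f > κ})` where `dm(z) = π⁻¹ (1+|z|²)⁻² dA(z)`. -/
noncomputable def muPoly (n : ℕ) (f : Polynomial ℂ) (κ : ℝ) : ℝ :=
  ∫ z in {z : ℂ | κ < uPoly n f z}, Real.pi⁻¹ * ((1 + ‖z‖^2)^2)⁻¹

/-- The real-linear map `v ↦ α v + β conj(v)`, i.e. the differential with Wirtinger derivatives
`α = ∂` and `β = ∂̄`. -/
noncomputable def wirtinger (α β : ℂ) : ℂ →L[ℝ] ℂ :=
  α • ContinuousLinearMap.id ℝ ℂ + β • (Complex.conjCLE : ℂ →L[ℝ] ℂ)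

@[simp] lemma wirtinger_apply (α β v : ℂ) :
    wirtinger α β v = α * v + β * (starRingEnd ℂ) v := by
  simp [wirtinger]

lemma HasFDerivAt.wirtinger_mul {F G : ℂ → ℂ} {a b c d z : ℂ}
    (hF : HasFDerivAt F (wirtinger a b) z) (hG : HasFDerivAt G (wirtinger c d) z) :
    HasFDerivAt (fun z => F z * G z) (wirtinger (F z * c + a * G z) (F z * d + b * G z)) z := by
  refine (hF.mul hG).congr_fderiv ?_
  ext
  simp
  ring

lemma HasDerivAt.wirtinger {F : ℂ → ℂ} {a z : ℂ} (hF : HasDerivAt F a z) :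
    HasFDerivAt F (wirtinger a 0) z := by
  refine (hF.hasFDerivAt.restrictScalars ℝ).congr_fderiv ?_
  ext
  simp [mul_comm]

lemma HasFDerivAt.wirtinger_conj {F : ℂ → ℂ} {a b z : ℂ}
    (hF : HasFDerivAt F (wirtinger a b) z) :
    HasFDerivAt (fun z => (starRingEnd ℂ) (F z))
      (wirtinger ((starRingEnd ℂ) b) ((starRingEnd ℂ) a)) z := by
  refine ((Complex.conjCLE : ℂ →L[ℝ] ℂ).hasFDerivAt.comp z hF).congr_fderiv ?_
  ext
  simp
  ring

lemma HasFDerivAt.wirtinger_add {F G : ℂ → ℂ} {a b c d z : ℂ}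
    (hF : HasFDerivAt F (wirtinger a b) z) (hG : HasFDerivAt G (wirtinger c d) z) :
    HasFDerivAt (fun z => F z + G z) (wirtinger (a + c) (b + d)) z := by
  refine (hF.add hG).congr_fderiv ?_
  ext
  simp
  ring

lemma HasFDerivAt.wirtinger_comp {F : ℂ → ℂ} {G : ℂ → ℂ} {a b c z : ℂ}
    (hG : HasDerivAt G c (F z)) (hF : HasFDerivAt F (wirtinger a b) z) :
    HasFDerivAt (fun z => G (F z)) (wirtinger (c * a) (c * b)) z := by
  refine (hG.wirtinger.comp z hF).congr_fderiv ?_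
  ext
  simp
  ring

/-- `G` is a continuously differentiable function with Wirtinger derivatives `α`, `β`, and all
three vanish outside the disk of radius `R`. -/
structure IsWirtingerTest (R : ℝ) (G α β : ℂ → ℂ) : Prop where
  deriv : ∀ z, HasFDerivAt G (wirtinger (α z) (β z)) z
  cont_α : Continuous α
  cont_β : Continuous β
  zero : ∀ z, R < ‖z‖ → G z = 0
  zero_α : ∀ z, R < ‖z‖ → α z = 0
  zero_β : ∀ z, R < ‖z‖ → β z = 0

namespace IsWirtingerTest

variable {R : ℝ} {G α β : ℂ → ℂ}

lemma cont (h : IsWirtingerTest R G α β) : Continuous G :=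
  continuous_iff_continuousAt.2 fun z => (h.deriv z).continuousAt

lemma mul (h : IsWirtingerTest R G α β) {P p q : ℂ → ℂ}
    (hP : ∀ z, HasFDerivAt P (wirtinger (p z) (q z)) z) (hp : Continuous p) (hq : Continuous q) :
    IsWirtingerTest R (fun z => P z * G z) (fun z => P z * α z + p z * G z)
      (fun z => P z * β z + q z * G z) where
  deriv z := (hP z).wirtinger_mul (h.deriv z)
  cont_α := by
    have : Continuous P := continuous_iff_continuousAt.2 fun z => (hP z).continuousAt
    have := h.cont; have := h.cont_α; fun_prop
  cont_β := by
    have : Continuous P := continuous_iff_continuousAt.2 fun z => (hP z).continuousAt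
    have := h.cont; have := h.cont_β; fun_prop
  zero z hz := by simp [h.zero z hz]
  zero_α z hz := by simp [h.zero z hz, h.zero_α z hz]
  zero_β z hz := by simp [h.zero z hz, h.zero_β z hz]

lemma comp_add (h : IsWirtingerTest R G α β) (w : ℂ) :
    IsWirtingerTest (R + ‖w‖) (fun z => G (z + w)) (fun z => α (z + w)) (fun z => β (z + w)) where
  deriv z := by
    have h1 : HasFDerivAt (fun z : ℂ => z + w) (ContinuousLinearMap.id ℝ ℂ) z :=
      (hasFDerivAt_id z).add_const w
    simpa using! (h.deriv (z + w)).comp z h1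
  cont_α := h.cont_α.comp (by fun_prop)
  cont_β := h.cont_β.comp (by fun_prop)
  zero z hz := h.zero _ (by have := norm_sub_le (z + w) w; simp at this; linarith)
  zero_α z hz := h.zero_α _ (by have := norm_sub_le (z + w) w; simp at this; linarith)
  zero_β z hz := h.zero_β _ (by have := norm_sub_le (z + w) w; simp at this; linarith)

end IsWirtingerTest

lemma hasCompactSupport_of_norm_lt {E : Type*} [Zero E] {R : ℝ} {G : ℂ → E}
    (h : ∀ z, R < ‖z‖ → G z = 0) : HasCompactSupport G := by
  refine HasCompactSupport.intro (isCompact_closedBall (0 : ℂ) R) fun z hz => h z ?_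
  simpa using hz

lemma integrable_of_norm_lt {E : Type*} [NormedAddCommGroup E] {R : ℝ} {G : ℂ → E}
    (hG : Continuous G) (h : ∀ z, R < ‖z‖ → G z = 0) : Integrable G :=
  hG.integrable_of_hasCompactSupport (hasCompactSupport_of_norm_lt h)

lemma integral_div_polar_zero {R : ℝ} {G α β : ℂ → ℂ} (h : IsWirtingerTest R G α β) :
    ∫ z, β z / z = -Real.pi * G 0 := by
  rw [← Complex.integral_comp_polarCoord_symm, show polarCoord.target = Set.Ioi (0 : ℝ) ×ˢ Set.Ioo (-Real.pi) Real.pi from rfl]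
  set e : ℝ → ℂ := fun θ => Real.cos θ + Real.sin θ * Complex.I with he
  have hec : Continuous e := by fun_prop
  have hne : ∀ θ, ‖e θ‖ = 1 := fun θ => by
    simp only [he, Complex.ofReal_cos, Complex.ofReal_sin, ← Complex.exp_mul_I,
      Complex.norm_exp_ofReal_mul_I]
  have hee : ∀ θ, e θ * (starRingEnd ℂ) (e θ) = 1 := fun θ => by
    rw [Complex.mul_conj, Complex.normSq_eq_norm_sq, hne]; simp
  have hed : ∀ θ, HasDerivAt e (Complex.I * e θ) θ := fun θ => by
    have h1 := (Real.hasDerivAt_cos θ).ofReal_comp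
    have h2 := (Real.hasDerivAt_sin θ).ofReal_comp
    refine (h1.add (h2.mul_const Complex.I)).congr_deriv ?_
    simp only [he]; push_cast; ring_nf; simp
  set A : ℝ × ℝ → ℂ := fun p => α (p.1 * e p.2) * e p.2
    + β (p.1 * e p.2) * (starRingEnd ℂ) (e p.2) with hA
  set B : ℝ × ℝ → ℂ := fun p => α (p.1 * e p.2) * (Complex.I * e p.2)
    + β (p.1 * e p.2) * (starRingEnd ℂ) (Complex.I * e p.2) with hB
  have hcα := h.cont_α
  have hcβ := h.cont_β
  have hAc : Continuous A := by fun_prop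
  have hBc : Continuous B := by fun_prop
  have key : ∀ p ∈ Set.Ioi (0 : ℝ) ×ˢ Set.Ioo (-Real.pi) Real.pi,
      p.1 • (β (Complex.polarCoord.symm p) / Complex.polarCoord.symm p)
        = (1 / 2 : ℂ) * A p + (Complex.I / 2) * B p := by
    rintro ⟨r, θ⟩ ⟨hr, -⟩
    have hr : (r : ℂ) ≠ 0 := by simpa using (ne_of_gt hr)
    have hse : Complex.polarCoord.symm (r, θ) = r * e θ := by
      rw [Complex.polarCoord_symm_apply]
    have he0 : e θ ≠ 0 := fun h0 => by simpa [h0] using hne θ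
    have hinv : (starRingEnd ℂ) (e θ) = (e θ)⁻¹ := eq_inv_of_mul_eq_one_right (hee θ)
    simp only [hse, hA, hB, hinv, map_mul, Complex.conj_I, Complex.real_smul]
    field_simp
    linear_combination (-(e θ)^2 * α (r * e θ) + β (r * e θ)) * Complex.I_sq
  have hpolar : ∀ F : ℝ × ℝ → ℂ, Continuous F → (∀ r θ, R < |r| → F (r, θ) = 0) →
      IntegrableOn F (Set.Ioi (0 : ℝ) ×ˢ Set.Ioo (-Real.pi) Real.pi) := by
    intro F hF h0
    have h1 : IntegrableOn F (Set.Icc 0 R ×ˢ Set.Icc (-Real.pi) Real.pi) :=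
      hF.continuousOn.integrableOn_compact (isCompact_Icc.prod isCompact_Icc)
    refine h1.of_forall_sdiff_eq_zero (measurableSet_Ioi.prod measurableSet_Ioo) ?_
    rintro ⟨r, θ⟩ ⟨⟨hr, hθ⟩, hn⟩
    apply h0
    by_contra! hR
    exact hn ⟨⟨le_of_lt hr, (le_abs_self r).trans hR⟩, ⟨hθ.1.le, hθ.2.le⟩⟩
  have hnorm : ∀ r θ : ℝ, ‖(r : ℂ) * e θ‖ = |r| := fun r θ => by simp [hne]
  have hA0 : ∀ r θ, R < |r| → A (r, θ) = 0 := fun r θ hr => by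
    rw [← hnorm r θ] at hr; simp [hA, h.zero_α _ hr, h.zero_β _ hr]
  have hB0 : ∀ r θ, R < |r| → B (r, θ) = 0 := fun r θ hr => by
    rw [← hnorm r θ] at hr; simp [hB, h.zero_α _ hr, h.zero_β _ hr]
  rw [setIntegral_congr_fun (measurableSet_Ioi.prod measurableSet_Ioo) key,
    integral_add ((hpolar A hAc hA0).const_mul _) ((hpolar B hBc hB0).const_mul _),
    integral_const_mul, integral_const_mul]
  have hIA : ∫ p in Set.Ioi (0 : ℝ) ×ˢ Set.Ioo (-Real.pi) Real.pi, A p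
      = -(2 * Real.pi) * G 0 := by
    have hi := hpolar A hAc hA0
    rw [Measure.volume_eq_prod] at hi ⊢
    rw [← Measure.prod_restrict] 
    rw [IntegrableOn, ← Measure.prod_restrict] at hi
    rw [integral_prod_symm _ hi]
    have : ∀ θ : ℝ, ∫ r in Set.Ioi (0 : ℝ), A (r, θ) = - G 0 := fun θ => by
      have hd : ∀ r ∈ Set.Ici (0 : ℝ), HasDerivAt (fun r : ℝ => G (r * e θ)) (A (r, θ)) r := by
        intro r _
        have h1 : HasDerivAt (fun r : ℝ => (r : ℂ) * e θ) (e θ) r := by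
          simpa using (Complex.ofRealCLM.hasDerivAt (x := r)).mul_const (e θ)
        exact ((h.deriv (r * e θ)).comp_hasDerivAt r h1).congr_deriv (by simp [hA])
      have hint1 : IntegrableOn (fun r => A (r, θ)) (Set.Ioi (0 : ℝ)) := by
        apply Integrable.integrableOn
        apply Continuous.integrable_of_hasCompactSupport (by fun_prop)
        refine HasCompactSupport.intro (isCompact_Icc (a := -R) (b := R)) fun r hr => hA0 _ _ ?_
        by_contra! hc
        exact hr (abs_le.1 hc)
      have ht : Filter.Tendsto (fun r : ℝ => G (r * e θ)) Filter.atTop (nhds 0) := by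
        refine tendsto_const_nhds.congr' ?_
        filter_upwards [Filter.eventually_gt_atTop R] with r hr
        exact (h.zero _ (by rw [hnorm]; exact hr.trans_le (le_abs_self r))).symm
      rw [integral_Ioi_of_hasDerivAt_of_tendsto' hd hint1 ht]
      simp
    simp only [this]
    rw [setIntegral_const, Measure.real, Real.volume_Ioo, ENNReal.toReal_ofReal (by linarith [Real.pi_pos]),
      Complex.real_smul]
    push_cast; ring
  have hIB : ∫ p in Set.Ioi (0 : ℝ) ×ˢ Set.Ioo (-Real.pi) Real.pi, B p = 0 := by
    have hi := hpolar B hBc hB0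
    rw [Measure.volume_eq_prod] at hi ⊢
    rw [setIntegral_prod _ hi]
    have : ∀ r ∈ Set.Ioi (0 : ℝ), ∫ θ in Set.Ioo (-Real.pi) Real.pi, B (r, θ) = 0 := by
      intro r hr
      have hr0 : (r : ℂ) ≠ 0 := by simpa using (ne_of_gt hr)
      rw [← integral_Ioc_eq_integral_Ioo, ← intervalIntegral.integral_of_le (by linarith [Real.pi_pos])]
      rw [intervalIntegral.integral_eq_sub_of_hasDerivAt (f := fun θ => (r : ℂ)⁻¹ * G (r * e θ))]
      · simp [he]
      · intro θ _
        have h1 : HasDerivAt (fun θ : ℝ => (r : ℂ) * e θ) (r * (Complex.I * e θ)) θ :=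
          (hed θ).const_mul _
        refine (((h.deriv (r * e θ)).comp_hasDerivAt θ h1).const_mul ((r : ℂ)⁻¹)).congr_deriv ?_
        simp [hB]
        field_simp
      · exact (by fun_prop : Continuous fun θ => B (r, θ)).intervalIntegrable _ _
    rw [setIntegral_congr_fun measurableSet_Ioi this]
    simp
  rw [hIA, hIB]
  ring

/-- **Cauchy–Pompeiu formula** for compactly supported functions. -/
lemma integral_dbar_div_sub {R : ℝ} {G α β : ℂ → ℂ} (h : IsWirtingerTest R G α β) (w : ℂ) :
    ∫ z, β z / (z - w) = -Real.pi * G w := by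
  have := integral_div_polar_zero (h.comp_add w)
  simp only [zero_add] at this
  rw [← this, ← integral_add_right_eq_self (fun z => β z / (z - w)) w]
  simp

/-- The function `1 + |z|²`, as a complex number. -/
noncomputable def onePlus (z : ℂ) : ℂ := 1 + z * (starRingEnd ℂ) z

lemma onePlus_eq (z : ℂ) : onePlus z = ((1 + ‖z‖ ^ 2 : ℝ) : ℂ) := by
  simp [onePlus, Complex.mul_conj, Complex.normSq_eq_norm_sq]

lemma onePlus_ne_zero (z : ℂ) : onePlus z ≠ 0 := by
  rw [onePlus_eq]
  exact_mod_cast (by positivity : (1 + ‖z‖ ^ 2 : ℝ) ≠ 0)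

lemma norm_onePlus (z : ℂ) : ‖onePlus z‖ = 1 + ‖z‖ ^ 2 := by
  rw [onePlus_eq, Complex.norm_real, Real.norm_of_nonneg (by positivity)]

@[fun_prop]
lemma continuous_onePlus : Continuous onePlus := by
  unfold onePlus; fun_prop

lemma hasFDerivAt_onePlus (z : ℂ) :
    HasFDerivAt onePlus (wirtinger ((starRingEnd ℂ) z) z) z := by
  have h := (hasDerivAt_id z).wirtinger
  have h1 := h.wirtinger_mul h.wirtinger_conj
  have h2 := ((hasDerivAt_const z (1 : ℂ)).wirtinger).wirtinger_add h1
  exact h2.congr_fderiv (by simp)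

lemma hasFDerivAt_onePlus_inv (z : ℂ) :
    HasFDerivAt (fun z => (onePlus z)⁻¹)
      (wirtinger (-((starRingEnd ℂ) z) / onePlus z ^ 2) (-z / onePlus z ^ 2)) z := by
  have h := HasFDerivAt.wirtinger_comp (hasDerivAt_inv (onePlus_ne_zero z)) (hasFDerivAt_onePlus z)
  refine h.congr_fderiv ?_
  congr 1 <;> ring

lemma integrable_indicator_ball_inv_norm (R : ℝ) :
    Integrable (fun y : ℂ => (Metric.ball (0 : ℂ) R).indicator (fun y => ‖y‖⁻¹) y) := by
  rw [integrable_indicator_iff measurableSet_ball]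
  rw [integrableOn_fun_norm_addHaar (E := ℂ) (μ := volume) (f := fun y : ℝ => y⁻¹)]
  have : IntegrableOn (fun _ : ℝ => (1 : ℝ)) (Set.Ioo 0 R) := by
    simp
  refine this.congr_fun (fun y hy => ?_) measurableSet_Ioo
  have : y ≠ 0 := hy.1.ne'
  simp [this]

lemma integrable_div_sub {R : ℝ} {H : ℂ → ℂ} (hH : Continuous H)
    (h0 : ∀ z, R < ‖z‖ → H z = 0) (w : ℂ) : Integrable (fun z => H z / (z - w)) := by
  obtain ⟨C, hC⟩ := hH.bounded_above_of_compact_support (hasCompactSupport_of_norm_lt h0)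
  have hC0 : 0 ≤ C := (norm_nonneg _).trans (hC 0)
  have hg := ((integrable_indicator_ball_inv_norm (R + ‖w‖ + 1)).comp_sub_right w).const_mul C
  refine hg.mono' (Measurable.aestronglyMeasurable (by have := hH.measurable; fun_prop)) ?_
  refine Filter.Eventually.of_forall fun z => ?_
  by_cases hz : R < ‖z‖
  · simp only [h0 z hz, zero_div, norm_zero]
    exact mul_nonneg hC0 (Set.indicator_nonneg (fun _ _ => by positivity) _)
  · have : z - w ∈ Metric.ball (0 : ℂ) (R + ‖w‖ + 1) := by
      have := norm_sub_le z w
      simp only [Metric.mem_ball, dist_zero_right]; linarith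
    rw [Set.indicator_of_mem this, norm_div, div_eq_mul_inv]
    exact mul_le_mul_of_nonneg_right (hC z) (by positivity)

section Kernel

variable {R : ℝ} {χ α β : ℂ → ℂ}

lemma integral_kernel_dbar_left (h : IsWirtingerTest R χ α β) (w : ℂ) :
    ∫ z, (starRingEnd ℂ) (z - w) / onePlus z * β z / (z - w) =
      -∫ z, (1 + z * (starRingEnd ℂ) w) / onePlus z ^ 2 * χ z / (z - w) := by
  have hP : ∀ z, HasFDerivAt (fun z => (starRingEnd ℂ) (z - w) * (onePlus z)⁻¹)
      (wirtinger ((starRingEnd ℂ) (z - w) * (-((starRingEnd ℂ) z) / onePlus z ^ 2))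
        ((1 + z * (starRingEnd ℂ) w) / onePlus z ^ 2)) z := by
    intro z
    have h1 := ((hasDerivAt_id z).sub_const w).wirtinger.wirtinger_conj
    have h2 := h1.wirtinger_mul (hasFDerivAt_onePlus_inv z)
    refine h2.congr_fderiv ?_
    have := onePlus_ne_zero z
    congr 1
    · simp
    · simp only [id, map_one, map_sub]
      field_simp
      unfold onePlus
      ring
  have hc1 : Continuous fun z => (starRingEnd ℂ) (z - w) *
      (-((starRingEnd ℂ) z) / onePlus z ^ 2) := by
    fun_prop (disch := intro z; exact pow_ne_zero _ (onePlus_ne_zero z))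
  have hc2 : Continuous fun z => (1 + z * (starRingEnd ℂ) w) / onePlus z ^ 2 := by
    fun_prop (disch := intro z; exact pow_ne_zero _ (onePlus_ne_zero z))
  have hc3 : Continuous fun z => (starRingEnd ℂ) (z - w) * (onePlus z)⁻¹ := by
    fun_prop (disch := intro z; exact onePlus_ne_zero z)
  have hT := h.mul hP hc1 hc2
  have key := integral_dbar_div_sub hT w
  have i1 := integrable_div_sub (R := R) (H := fun z => (starRingEnd ℂ) (z - w) * (onePlus z)⁻¹ * β z)
    (hc3.mul h.cont_β) (fun z hz => by simp [h.zero_β z hz]) w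
  have i2 := integrable_div_sub (R := R) (H := fun z => (1 + z * (starRingEnd ℂ) w) / onePlus z ^ 2 * χ z)
    (hc2.mul h.cont) (fun z hz => by simp [h.zero z hz]) w
  have hsplit : ∀ z, ((starRingEnd ℂ) (z - w) * (onePlus z)⁻¹ * β z +
      (1 + z * (starRingEnd ℂ) w) / onePlus z ^ 2 * χ z) / (z - w) =
      (starRingEnd ℂ) (z - w) * (onePlus z)⁻¹ * β z / (z - w) +
      (1 + z * (starRingEnd ℂ) w) / onePlus z ^ 2 * χ z / (z - w) := fun z => add_div _ _ _
  simp only [hsplit] at key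
  rw [integral_add i1 i2] at key
  simp only [sub_self, map_zero, zero_mul, mul_zero] at key
  simp only [div_eq_mul_inv] at key ⊢
  exact eq_neg_of_add_eq_zero_left key

lemma integral_kernel_dbar_right (h : IsWirtingerTest R χ α β) (z : ℂ) :
    ∫ w, (1 + z * (starRingEnd ℂ) w) / onePlus w * β w / (z - w) =
      Real.pi * χ z - ∫ w, χ w / onePlus w ^ 2 := by
  have hP : ∀ w, HasFDerivAt (fun w => (1 + z * (starRingEnd ℂ) w) * (onePlus w)⁻¹)
      (wirtinger ((1 + z * (starRingEnd ℂ) w) * (-((starRingEnd ℂ) w) / onePlus w ^ 2))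
        ((z - w) / onePlus w ^ 2)) w := by
    intro w
    have h0 := (((hasDerivAt_id w).wirtinger.wirtinger_conj).wirtinger_mul
      (hasDerivAt_const w z).wirtinger)
    have h1 := ((hasDerivAt_const w (1 : ℂ)).wirtinger).wirtinger_add h0
    have h2 := h1.wirtinger_mul (hasFDerivAt_onePlus_inv w)
    have h3 : (fun w => (1 + z * (starRingEnd ℂ) w) * (onePlus w)⁻¹) =
      fun w => (1 + (starRingEnd ℂ) (id w) * z) * (onePlus w)⁻¹ := by
      ext w; simp [mul_comm]
    rw [h3]
    refine h2.congr_fderiv ?_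
    have := onePlus_ne_zero w
    congr 1
    · simp [mul_comm]
    · simp only [id, map_one]
      field_simp
      unfold onePlus
      ring
  have hc1 : Continuous fun w => (1 + z * (starRingEnd ℂ) w) *
      (-((starRingEnd ℂ) w) / onePlus w ^ 2) := by
    fun_prop (disch := intro z; exact pow_ne_zero _ (onePlus_ne_zero z))
  have hc2 : Continuous fun w => (z - w) / onePlus w ^ 2 := by
    fun_prop (disch := intro z; exact pow_ne_zero _ (onePlus_ne_zero z))
  have hc3 : Continuous fun w => (1 + z * (starRingEnd ℂ) w) * (onePlus w)⁻¹ := by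
    fun_prop (disch := intro z; exact onePlus_ne_zero z)
  have hT := h.mul hP hc1 hc2
  have key := integral_dbar_div_sub hT z
  have i1 := integrable_div_sub (R := R) (H := fun w => (1 + z * (starRingEnd ℂ) w) * (onePlus w)⁻¹ * β w)
    (hc3.mul h.cont_β) (fun z hz => by simp [h.zero_β z hz]) z
  have i2 := integrable_div_sub (R := R) (H := fun w => (z - w) / onePlus w ^ 2 * χ w)
    (hc2.mul h.cont) (fun z hz => by simp [h.zero z hz]) z
  have hsplit : ∀ w, ((1 + z * (starRingEnd ℂ) w) * (onePlus w)⁻¹ * β w +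
      (z - w) / onePlus w ^ 2 * χ w) / (w - z) =
      (1 + z * (starRingEnd ℂ) w) * (onePlus w)⁻¹ * β w / (w - z) +
      (z - w) / onePlus w ^ 2 * χ w / (w - z) := fun w => add_div _ _ _
  simp only [hsplit] at key
  rw [integral_add i1 i2] at key
  have e2 : ∫ w, (z - w) / onePlus w ^ 2 * χ w / (w - z) = -∫ w, χ w / onePlus w ^ 2 := by
    rw [← integral_neg]
    apply integral_congr_ae
    filter_upwards [compl_mem_ae_iff.2 (measure_singleton z)] with w hw
    have h1 : w - z ≠ 0 := sub_ne_zero.2 hw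
    have := onePlus_ne_zero w
    field_simp
    ring
  have e1 : ∫ w, (1 + z * (starRingEnd ℂ) w) / onePlus w * β w / (z - w) =
      -∫ w, (1 + z * (starRingEnd ℂ) w) * (onePlus w)⁻¹ * β w / (w - z) := by
    rw [← integral_neg]
    congr 1; ext w
    rw [← neg_sub w z, div_neg, div_eq_mul_inv (1 + _) (onePlus w)]
  have e3 : (1 + z * (starRingEnd ℂ) z) * (onePlus z)⁻¹ = 1 := mul_inv_cancel₀ (onePlus_ne_zero z)
  rw [e2, e3] at key
  rw [e1]
  linear_combination -key

lemma integrable_kernel_prod (h : IsWirtingerTest R χ α β) :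
    Integrable (fun p : ℂ × ℂ => (χ p.1 / onePlus p.1 ^ 2) *
      ((1 + p.1 * (starRingEnd ℂ) p.2) / onePlus p.2 * β p.2 / (p.1 - p.2))) := by
  have hc1 : Continuous fun z => χ z / onePlus z ^ 2 := by
    have := h.cont
    fun_prop (disch := intro z; exact pow_ne_zero _ (onePlus_ne_zero z))
  obtain ⟨C, hC⟩ := hc1.bounded_above_of_compact_support
    (hasCompactSupport_of_norm_lt (R := R) fun z hz => by simp [h.zero z hz])
  have hC0 : 0 ≤ C := (norm_nonneg _).trans (hC 0)
  have hf : Integrable (fun w => C * (1 + R * R) * (‖β w‖ / ‖onePlus w‖)) := by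
    apply integrable_of_norm_lt (R := R)
    · have := h.cont_β
      fun_prop (disch := intro z; exact norm_ne_zero_iff.2 (onePlus_ne_zero z))
    · intro w hw; simp [h.zero_β w hw]
  have hg := integrable_indicator_ball_inv_norm (2 * R + 1)
  have := hf.convolution_integrand (ContinuousLinearMap.mul ℝ ℝ) hg
  rw [Measure.volume_eq_prod]
  refine this.mono' (Measurable.aestronglyMeasurable ?_) ?_
  · have := h.cont.measurable
    have := h.cont_β.measurable
    have := continuous_onePlus.measurable
    have := Complex.continuous_conj.measurable
    fun_prop
  · refine Filter.Eventually.of_forall fun ⟨z, w⟩ => ?_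
    simp only [ContinuousLinearMap.mul_apply']
    by_cases hzw : ‖z‖ ≤ R ∧ ‖w‖ ≤ R
    · obtain ⟨hz, hw⟩ := hzw
      have hR : 0 ≤ R := (norm_nonneg z).trans hz
      have hmem : z - w ∈ Metric.ball (0 : ℂ) (2 * R + 1) := by
        have := norm_sub_le z w
        simp only [Metric.mem_ball, dist_zero_right]; linarith
      rw [Set.indicator_of_mem hmem, norm_mul, norm_div (_ * _), norm_mul (_ / _), norm_div (1 + _)]
      have h1 : ‖1 + z * (starRingEnd ℂ) w‖ ≤ 1 + R * R := by
        refine (norm_add_le _ _).trans ?_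
        rw [norm_mul, RCLike.norm_conj, norm_one]
        gcongr
      calc _ ≤ C * ((1 + R * R) / ‖onePlus w‖ * ‖β w‖ / ‖z - w‖) := by
            gcongr
            exact hC z
        _ = _ := by rw [div_eq_mul_inv _ ‖z - w‖]; ring
    · have hzero : (χ z / onePlus z ^ 2) *
          ((1 + z * (starRingEnd ℂ) w) / onePlus w * β w / (z - w)) = 0 := by
        rw [not_and_or, not_le, not_le] at hzw
        rcases hzw with hz | hw
        · simp [h.zero z hz]
        · simp [h.zero_β w hw]
      rw [hzero, norm_zero]
      refine mul_nonneg ?_ (Set.indicator_nonneg (fun _ _ => by positivity) _)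
      have : 0 ≤ R * R := mul_self_nonneg R
      positivity

lemma integral_integral_kernel (h : IsWirtingerTest R χ α β) :
    ∫ w, β w / onePlus w * ∫ z, (starRingEnd ℂ) (z - w) / onePlus z * β z / (z - w) =
      (∫ z, χ z / onePlus z ^ 2) ^ 2 - Real.pi * ∫ z, χ z ^ 2 / onePlus z ^ 2 := by
  have hN : ∀ z, onePlus z ^ 2 ≠ 0 := fun z => pow_ne_zero _ (onePlus_ne_zero z)
  have hcχ := h.cont
  have i1 : Integrable fun z => χ z / onePlus z ^ 2 :=
    integrable_of_norm_lt (R := R) (by fun_prop (disch := exact hN))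
      fun z hz => by simp [h.zero z hz]
  have i2 : Integrable fun z => χ z ^ 2 / onePlus z ^ 2 :=
    integrable_of_norm_lt (R := R) (by fun_prop (disch := exact hN))
      fun z hz => by simp [h.zero z hz]
  have e1 : ∀ w, β w / onePlus w *
      ∫ z, (starRingEnd ℂ) (z - w) / onePlus z * β z / (z - w) =
      -∫ z, (χ z / onePlus z ^ 2) *
        ((1 + z * (starRingEnd ℂ) w) / onePlus w * β w / (z - w)) := by
    intro w
    rw [integral_kernel_dbar_left h w, mul_neg, ← integral_const_mul]
    congr 2; ext z; ring
  simp only [e1]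
  rw [integral_neg, ← integral_integral_swap (integrable_kernel_prod h)]
  simp only [integral_const_mul, integral_kernel_dbar_right h]
  have e2 : ∀ z, χ z / onePlus z ^ 2 * (Real.pi * χ z - ∫ w, χ w / onePlus w ^ 2) =
      Real.pi * (χ z ^ 2 / onePlus z ^ 2) - (∫ w, χ w / onePlus w ^ 2) * (χ z / onePlus z ^ 2) :=
    fun z => by ring
  simp only [e2]
  rw [integral_sub (i2.const_mul _) (i1.const_mul _), integral_const_mul, integral_const_mul]
  ring

/-- A sharp `L¹` Poincaré–Sobolev inequality on the sphere, in stereographic coordinates. -/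
lemma norm_variance_le (h : IsWirtingerTest R χ α β) :
    ‖Real.pi * (∫ z, χ z ^ 2 / onePlus z ^ 2) - (∫ z, χ z / onePlus z ^ 2) ^ 2‖ ≤
      (∫ z, ‖β z‖ / (1 + ‖z‖ ^ 2)) ^ 2 := by
  rw [norm_sub_rev, ← integral_integral_kernel h]
  have hcβ := h.cont_β
  have hi : Integrable fun z => ‖β z‖ / (1 + ‖z‖ ^ 2) :=
    integrable_of_norm_lt (R := R) (by fun_prop (disch := intro z; positivity))
      fun z hz => by simp [h.zero_β z hz]
  have hb : ∀ w, ‖β w / onePlus w * ∫ z, (starRingEnd ℂ) (z - w) / onePlus z * β z / (z - w)‖ ≤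
      (∫ z, ‖β z‖ / (1 + ‖z‖ ^ 2)) * (‖β w‖ / (1 + ‖w‖ ^ 2)) := by
    intro w
    rw [norm_mul, norm_div, norm_onePlus, mul_comm]
    gcongr
    refine norm_integral_le_of_norm_le hi (Filter.Eventually.of_forall fun z => ?_)
    rw [norm_div, norm_mul, norm_div, norm_onePlus, RCLike.norm_conj]
    have h1 : ‖z - w‖ / ‖z - w‖ ≤ 1 := div_self_le_one _
    calc ‖z - w‖ / (1 + ‖z‖ ^ 2) * ‖β z‖ / ‖z - w‖ =
        (‖z - w‖ / ‖z - w‖) * (‖β z‖ / (1 + ‖z‖ ^ 2)) := by ring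
      _ ≤ 1 * (‖β z‖ / (1 + ‖z‖ ^ 2)) := by gcongr
      _ = _ := one_mul _
  refine (norm_integral_le_of_norm_le (hi.const_mul _) (Filter.Eventually.of_forall hb)).trans ?_
  rw [integral_const_mul, sq]

end Kernel

lemma IsWirtingerTest.integral_eq_zero {R : ℝ} {G α β : ℂ → ℂ} (h : IsWirtingerTest R G α β) :
    ∫ z, α z = 0 := by
  have hcα := h.cont_α
  have hcβ := h.cont_β
  have hfd : ∀ z, fderiv ℝ G z = wirtinger (α z) (β z) := fun z => (h.deriv z).fderiv
  have iG : Integrable G := integrable_of_norm_lt h.cont h.zero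
  have iv : ∀ v : ℂ, Integrable fun z => α z * v + β z * (starRingEnd ℂ) v := fun v =>
    integrable_of_norm_lt (R := R) (by fun_prop)
      fun z hz => by simp [h.zero_α z hz, h.zero_β z hz]
  have key : ∀ v : ℂ, ∫ z, (α z * v + β z * (starRingEnd ℂ) v) = 0 := by
    intro v
    have := integral_mul_fderiv_eq_neg_fderiv_mul_of_integrable (μ := (volume : Measure ℂ))
      (f := fun _ : ℂ => (1 : ℂ)) (g := G) (v := v) (by simp) (by simpa [hfd] using iv v)
      (by simpa using iG) (fun _ _ => by fun_prop) (fun z _ => (h.deriv z).differentiableAt)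
    simpa [hfd] using this
  have e : ∀ z, α z = 2⁻¹ * (α z * 1 + β z * (starRingEnd ℂ) 1) -
      (Complex.I / 2) * (α z * Complex.I + β z * (starRingEnd ℂ) Complex.I) := by
    intro z
    simp only [map_one, Complex.conj_I]
    linear_combination (2⁻¹ * α z - 2⁻¹ * β z) * Complex.I_sq
  rw [integral_congr_ae (Filter.Eventually.of_forall e), integral_sub ((iv 1).const_mul _)
    ((iv Complex.I).const_mul _), integral_const_mul, integral_const_mul, key, key]
  simp

/-- The square of `uPoly`. -/
noncomputable def uSq (n : ℕ) (f : Polynomial ℂ) (z : ℂ) : ℝ :=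
  ‖f.eval z‖ ^ 2 / (1 + ‖z‖ ^ 2) ^ n

/-- The Wirtinger derivative `∂̄` of `uSq n f`. -/
noncomputable def uSqDbar (n : ℕ) (f : Polynomial ℂ) (z : ℂ) : ℂ :=
  (onePlus z)⁻¹ ^ n * f.eval z * ((starRingEnd ℂ) (f.derivative.eval z) -
    n * z * (starRingEnd ℂ) (f.eval z) * (onePlus z)⁻¹)

section Level

variable (n : ℕ) (f : Polynomial ℂ)

lemma uSq_nonneg (z : ℂ) : 0 ≤ uSq n f z := by
  unfold uSq; positivity

@[fun_prop]
lemma continuous_uSq : Continuous (uSq n f) := by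
  unfold uSq
  fun_prop (disch := intro z; positivity)

lemma ofReal_uSq (z : ℂ) :
    (uSq n f z : ℂ) = (onePlus z)⁻¹ ^ n * (f.eval z * (starRingEnd ℂ) (f.eval z)) := by
  rw [Complex.mul_conj, Complex.normSq_eq_norm_sq, onePlus_eq, uSq]
  push_cast
  rw [div_eq_mul_inv, inv_pow]
  ring

lemma hasFDerivAt_onePlus_inv_pow (z : ℂ) :
    HasFDerivAt (fun z => (onePlus z)⁻¹ ^ n)
      (wirtinger (-n * (starRingEnd ℂ) z * ((onePlus z)⁻¹ ^ n * (onePlus z)⁻¹))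
        (-n * z * ((onePlus z)⁻¹ ^ n * (onePlus z)⁻¹))) z := by
  have h := HasFDerivAt.wirtinger_comp (F := fun z => (onePlus z)⁻¹) (hasDerivAt_pow n _)
    (hasFDerivAt_onePlus_inv z)
  refine h.congr_fderiv ?_
  have := onePlus_ne_zero z
  rcases n with _ | n
  · simp
  · congr 1 <;>
    · simp only [Nat.add_sub_cancel, pow_succ]
      field_simp

lemma hasFDerivAt_uSq (z : ℂ) :
    HasFDerivAt (fun z => (uSq n f z : ℂ))
      (wirtinger ((starRingEnd ℂ) (uSqDbar n f z)) (uSqDbar n f z)) z := by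
  simp only [ofReal_uSq]
  have hf := (f.hasDerivAt z).wirtinger
  refine ((hasFDerivAt_onePlus_inv_pow n z).wirtinger_mul
    (hf.wirtinger_mul hf.wirtinger_conj)).congr_fderiv ?_
  have hc : (starRingEnd ℂ) (onePlus z) = onePlus z := by rw [onePlus_eq, Complex.conj_ofReal]
  congr 1
  · simp only [uSqDbar, map_mul, map_sub, map_pow, map_inv₀, hc, Complex.conj_conj, map_natCast,
      map_zero]
    ring
  · simp only [uSqDbar]
    ring

lemma hasFDerivAt_ofReal_comp_uSq {η : ℝ → ℝ} {e : ℝ} (z : ℂ) (h : HasDerivAt η e (uSq n f z)) :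
    HasFDerivAt (fun z => (η (uSq n f z) : ℂ))
      (wirtinger (e * (starRingEnd ℂ) (uSqDbar n f z)) (e * uSqDbar n f z)) z := by
  have h1 : HasFDerivAt (uSq n f) _ z := Complex.reCLM.hasFDerivAt.comp z (hasFDerivAt_uSq n f z)
  have h2 := Complex.ofRealCLM.hasFDerivAt.comp z (h.comp_hasFDerivAt z h1)
  refine h2.congr_fderiv ?_
  ext v
  apply Complex.ext <;> simp <;> ring

lemma exists_hasFDerivAt_uSqDbar : ∃ p q : ℂ → ℂ, Continuous p ∧ Continuous q ∧
    (∀ z, HasFDerivAt (uSqDbar n f) (wirtinger (p z) (q z)) z) ∧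
    ∀ z, uSq n f z * p z = uSqDbar n f z * (starRingEnd ℂ) (uSqDbar n f z) -
      n * uSq n f z ^ 2 * (onePlus z)⁻¹ ^ 2 := by
  have hN := onePlus_ne_zero
  have hd : ∀ z, HasFDerivAt (uSqDbar n f) _ z := fun z => by
    have hf := (f.hasDerivAt z).wirtinger
    have hf' := (f.derivative.hasDerivAt z).wirtinger
    have hz := ((hasDerivAt_id z).const_mul (n : ℂ)).wirtinger
    have hq := ((hz.wirtinger_mul hf.wirtinger_conj).wirtinger_mul
      (hasFDerivAt_onePlus_inv z)).wirtinger_mul (hasDerivAt_const z (-1 : ℂ)).wirtinger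
    have := ((hasFDerivAt_onePlus_inv_pow n z).wirtinger_mul hf).wirtinger_mul
      (hf'.wirtinger_conj.wirtinger_add hq)
    have e : uSqDbar n f = fun z => (onePlus z)⁻¹ ^ n * f.eval z *
        ((starRingEnd ℂ) (f.derivative.eval z) +
          n * id z * (starRingEnd ℂ) (f.eval z) * (onePlus z)⁻¹ * (-1)) := by
      ext z; simp only [uSqDbar, id]; ring
    rw [e]
    exact this
  refine ⟨_, _, ?_, ?_, hd, ?_⟩
  · fun_prop (disch := first | exact hN | exact fun z => pow_ne_zero _ (hN z))
  · fun_prop (disch := first | exact hN | exact fun z => pow_ne_zero _ (hN z))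
  · intro z
    have hc : (starRingEnd ℂ) (onePlus z) = onePlus z := by rw [onePlus_eq, Complex.conj_ofReal]
    simp only [ofReal_uSq, uSqDbar, map_mul, map_sub, map_pow, map_inv₀, hc, Complex.conj_conj,
      map_natCast, map_zero, id]
    have h1 : (onePlus z)⁻¹ * (1 + z * (starRingEnd ℂ) z) = 1 := inv_mul_cancel₀ (hN z)
    set M := (onePlus z)⁻¹ with hM
    simp only [div_eq_mul_inv, ← inv_pow, ← hM]
    set F := f.eval z
    set F' := f.derivative.eval z
    set c := (starRingEnd ℂ) F
    set c' := (starRingEnd ℂ) F'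
    set y := (starRingEnd ℂ) z
    linear_combination (n * (M ^ n) ^ 2 * M * F ^ 2 * c ^ 2) * h1

end Level

lemma integral_uSq_energy {n : ℕ} {f : Polynomial ℂ} {a R : ℝ} (ha : 0 < a)
    (hR : ∀ z, R < ‖z‖ → uSq n f z ≤ a) {η e : ℝ → ℝ} (hη : ∀ s, HasDerivAt η (e s) s)
    (he : Continuous e) (hη0 : ∀ s ≤ a, η s = 0) (he0 : ∀ s ≤ a, e s = 0) :
    ∫ z, e (uSq n f z) * ‖uSqDbar n f z‖ ^ 2 / uSq n f z =
      n * ∫ z, η (uSq n f z) / (1 + ‖z‖ ^ 2) ^ 2 := by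
  have hηc : Continuous η := continuous_iff_continuousAt.2 fun s => (hη s).continuousAt
  have hev : ∀ s < a, ∀ᶠ t in nhds s, t ≤ a := fun s hs =>
    (eventually_lt_nhds hs).mono fun t ht => ht.le
  have hd : ∀ s, HasDerivAt (fun s => η s / s) ((e s * s - η s) / s ^ 2) s := by
    intro s
    rcases lt_or_ge s a with hs | hs
    · rw [he0 s hs.le, hη0 s hs.le]
      simp only [zero_mul, sub_zero, zero_div]
      refine (hasDerivAt_const s (0 : ℝ)).congr_of_eventuallyEq ?_
      filter_upwards [hev s hs] with t ht
      simp [hη0 t ht]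
    · exact ((hη s).div (hasDerivAt_id s) (ha.trans_le hs).ne').congr_deriv (by simp)
  have hcd : Continuous fun s => (e s * s - η s) / s ^ 2 := by
    rw [continuous_iff_continuousAt]
    intro s
    rcases lt_or_ge s a with hs | hs
    · refine (continuousAt_const (y := (0 : ℝ))).congr ?_
      filter_upwards [hev s hs] with t ht
      simp [hη0 t ht, he0 t ht]
    · have : s ^ 2 ≠ 0 := pow_ne_zero _ (ha.trans_le hs).ne'
      fun_prop (disch := assumption)
  have hce : Continuous fun s => e s / s := by
    rw [continuous_iff_continuousAt]
    intro s
    rcases lt_or_ge s a with hs | hs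
    · refine (continuousAt_const (y := (0 : ℝ))).congr ?_
      filter_upwards [hev s hs] with t ht
      simp [he0 t ht]
    · have : s ≠ 0 := (ha.trans_le hs).ne'
      fun_prop (disch := assumption)
  obtain ⟨p, q, hp, hq, hb, hpq⟩ := exists_hasFDerivAt_uSqDbar n f
  have hbc : Continuous (uSqDbar n f) :=
    continuous_iff_continuousAt.2 fun z => (hb z).continuousAt
  have hU := continuous_uSq n f
  have hT : IsWirtingerTest R (fun z => ((η (uSq n f z) / uSq n f z : ℝ) : ℂ))
      (fun z => (((e (uSq n f z) * uSq n f z - η (uSq n f z)) / uSq n f z ^ 2 : ℝ) : ℂ) *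
        (starRingEnd ℂ) (uSqDbar n f z))
      (fun z => (((e (uSq n f z) * uSq n f z - η (uSq n f z)) / uSq n f z ^ 2 : ℝ) : ℂ) *
        uSqDbar n f z) := {
    deriv := fun z => hasFDerivAt_ofReal_comp_uSq n f z (hd _)
    cont_α := (Complex.continuous_ofReal.comp (hcd.comp hU)).mul
      (Complex.continuous_conj.comp hbc)
    cont_β := (Complex.continuous_ofReal.comp (hcd.comp hU)).mul hbc
    zero := fun z hz => by simp [hη0 _ (hR z hz)]
    zero_α := fun z hz => by simp [hη0 _ (hR z hz), he0 _ (hR z hz)]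
    zero_β := fun z hz => by simp [hη0 _ (hR z hz), he0 _ (hR z hz)] }
  have key := (hT.mul hb hp hq).integral_eq_zero
  have hpt : ∀ z, uSqDbar n f z *
      ((((e (uSq n f z) * uSq n f z - η (uSq n f z)) / uSq n f z ^ 2 : ℝ) : ℂ) *
        (starRingEnd ℂ) (uSqDbar n f z)) + p z * ((η (uSq n f z) / uSq n f z : ℝ) : ℂ) =
      ((e (uSq n f z) * ‖uSqDbar n f z‖ ^ 2 / uSq n f z -
        n * (η (uSq n f z) / (1 + ‖z‖ ^ 2) ^ 2) : ℝ) : ℂ) := by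
    intro z
    rcases le_or_gt (uSq n f z) a with hs | hs
    · simp [hη0 _ hs, he0 _ hs]
    · have hU0 : (uSq n f z : ℂ) ≠ 0 := by exact_mod_cast (ha.trans hs).ne'
      have hbb : ((‖uSqDbar n f z‖ : ℝ) : ℂ) ^ 2 =
          uSqDbar n f z * (starRingEnd ℂ) (uSqDbar n f z) := by
        rw [Complex.mul_conj, Complex.normSq_eq_norm_sq]; push_cast; ring
      have hN := onePlus_ne_zero z
      have hN' : (1 + (‖z‖ : ℂ) ^ 2) = onePlus z := by rw [onePlus_eq]; push_cast; ring
      have h1 := hpq z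
      push_cast
      rw [hN', hbb]
      rw [inv_pow] at h1
      have h2 : p z = (uSqDbar n f z * (starRingEnd ℂ) (uSqDbar n f z) -
        n * uSq n f z ^ 2 * (onePlus z ^ 2)⁻¹) / uSq n f z := by
        rw [eq_div_iff hU0, mul_comm, h1]
      rw [h2]
      field_simp
      ring
  simp only [hpt] at key
  rw [integral_complex_ofReal, Complex.ofReal_eq_zero, integral_sub, integral_const_mul] at key
  · linarith
  · apply integrable_of_norm_lt (R := R)
    · have : Continuous fun z => (e (uSq n f z) / uSq n f z) * ‖uSqDbar n f z‖ ^ 2 :=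
        (hce.comp hU).mul (by fun_prop)
      exact this.congr fun z => by ring
    · intro z hz; simp [he0 _ (hR z hz)]
  · apply Integrable.const_mul
    apply integrable_of_norm_lt (R := R)
    · fun_prop (disch := intro z; positivity)
    · intro z hz; simp [hη0 _ (hR z hz)]

lemma sq_integral_gradient_le {n : ℕ} {f : Polynomial ℂ} {a R : ℝ} (ha : 0 < a)
    (hR : ∀ z, R < ‖z‖ → uSq n f z ≤ a) {e : ℝ → ℝ}
    (he : Continuous e) (he_nn : ∀ s, 0 ≤ e s) (he0 : ∀ s ≤ a, e s = 0) :
    (∫ z, e (uSq n f z) * ‖uSqDbar n f z‖ / (1 + ‖z‖ ^ 2)) ^ 2 ≤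
      (∫ z, e (uSq n f z) * ‖uSqDbar n f z‖ ^ 2 / uSq n f z) *
        ∫ z, e (uSq n f z) * uSq n f z / (1 + ‖z‖ ^ 2) ^ 2 := by
  have hce : Continuous fun s => e s / s := by
    rw [continuous_iff_continuousAt]
    intro s
    rcases lt_or_ge s a with hs | hs
    · refine (continuousAt_const (y := (0 : ℝ))).congr ?_
      filter_upwards [eventually_lt_nhds hs] with t ht
      simp [he0 t ht.le]
    · have : s ≠ 0 := (ha.trans_le hs).ne'
      fun_prop (disch := assumption)
  obtain ⟨p, q, -, -, hb, -⟩ := exists_hasFDerivAt_uSqDbar n f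
  have hbc : Continuous (uSqDbar n f) :=
    continuous_iff_continuousAt.2 fun z => (hb z).continuousAt
  have hU := continuous_uSq n f
  have i1 : Integrable fun z => e (uSq n f z) * ‖uSqDbar n f z‖ ^ 2 / uSq n f z := by
    apply integrable_of_norm_lt (R := R)
    · have : Continuous fun z => (e (uSq n f z) / uSq n f z) * ‖uSqDbar n f z‖ ^ 2 :=
        (hce.comp hU).mul (by fun_prop)
      exact this.congr fun z => by ring
    · intro z hz; simp [he0 _ (hR z hz)]
  have i2 : Integrable fun z => e (uSq n f z) * ‖uSqDbar n f z‖ / (1 + ‖z‖ ^ 2) := by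
    apply integrable_of_norm_lt (R := R)
    · fun_prop (disch := intro z; positivity)
    · intro z hz; simp [he0 _ (hR z hz)]
  have i3 : Integrable fun z => e (uSq n f z) * uSq n f z / (1 + ‖z‖ ^ 2) ^ 2 := by
    apply integrable_of_norm_lt (R := R)
    · fun_prop (disch := intro z; positivity)
    · intro z hz; simp [he0 _ (hR z hz)]
  have key : ∀ x : ℝ, 0 ≤ (∫ z, e (uSq n f z) * ‖uSqDbar n f z‖ ^ 2 / uSq n f z) * (x * x) +
      (-2 * ∫ z, e (uSq n f z) * ‖uSqDbar n f z‖ / (1 + ‖z‖ ^ 2)) * x +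
      ∫ z, e (uSq n f z) * uSq n f z / (1 + ‖z‖ ^ 2) ^ 2 := by
    intro x
    have hsum : ∫ z, (e (uSq n f z) * ‖uSqDbar n f z‖ ^ 2 / uSq n f z * (x * x) +
        (e (uSq n f z) * ‖uSqDbar n f z‖ / (1 + ‖z‖ ^ 2)) * (-2 * x) +
        e (uSq n f z) * uSq n f z / (1 + ‖z‖ ^ 2) ^ 2) =
        (∫ z, e (uSq n f z) * ‖uSqDbar n f z‖ ^ 2 / uSq n f z) * (x * x) +
      (-2 * ∫ z, e (uSq n f z) * ‖uSqDbar n f z‖ / (1 + ‖z‖ ^ 2)) * x +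
      ∫ z, e (uSq n f z) * uSq n f z / (1 + ‖z‖ ^ 2) ^ 2 := by
      have i12 : Integrable fun z => e (uSq n f z) * ‖uSqDbar n f z‖ ^ 2 / uSq n f z * (x * x) +
        (e (uSq n f z) * ‖uSqDbar n f z‖ / (1 + ‖z‖ ^ 2)) * (-2 * x) :=
        (i1.mul_const _).add (i2.mul_const _)
      rw [integral_add i12 i3,
        integral_add (i1.mul_const _) (i2.mul_const _), integral_mul_const, integral_mul_const]
      ring
    rw [← hsum]
    refine integral_nonneg fun z => ?_
    rcases le_or_gt (uSq n f z) a with hs | hs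
    · simp [he0 _ hs]
    · have hU0 : uSq n f z ≠ 0 := (ha.trans hs).ne'
      have hN : (1 + ‖z‖ ^ 2) ≠ 0 := by positivity
      have : e (uSq n f z) * ‖uSqDbar n f z‖ ^ 2 / uSq n f z * (x * x) +
        (e (uSq n f z) * ‖uSqDbar n f z‖ / (1 + ‖z‖ ^ 2)) * (-2 * x) +
        e (uSq n f z) * uSq n f z / (1 + ‖z‖ ^ 2) ^ 2 =
        e (uSq n f z) / uSq n f z *
          (x * ‖uSqDbar n f z‖ - uSq n f z / (1 + ‖z‖ ^ 2)) ^ 2 := by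
        field_simp
        ring
      simp only [Pi.zero_apply]
      rw [this]
      exact mul_nonneg (div_nonneg (he_nn _) (uSq_nonneg n f z)) (sq_nonneg _)
  have := discrim_le_zero key
  rw [discrim] at this
  nlinarith

lemma variance_uSq_le {n : ℕ} {f : Polynomial ℂ} {a R : ℝ} (ha : 0 < a)
    (hR : ∀ z, R < ‖z‖ → uSq n f z ≤ a) {η e : ℝ → ℝ} (hη : ∀ s, HasDerivAt η (e s) s)
    (he : Continuous e) (he_nn : ∀ s, 0 ≤ e s)
    (hη0 : ∀ s ≤ a, η s = 0) (he0 : ∀ s ≤ a, e s = 0) :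
    Real.pi * (∫ z, η (uSq n f z) ^ 2 / (1 + ‖z‖ ^ 2) ^ 2) -
        (∫ z, η (uSq n f z) / (1 + ‖z‖ ^ 2) ^ 2) ^ 2 ≤
      n * (∫ z, η (uSq n f z) / (1 + ‖z‖ ^ 2) ^ 2) *
        ∫ z, e (uSq n f z) * uSq n f z / (1 + ‖z‖ ^ 2) ^ 2 := by
  obtain ⟨p, q, -, -, hb, -⟩ := exists_hasFDerivAt_uSqDbar n f
  have hbc : Continuous (uSqDbar n f) :=
    continuous_iff_continuousAt.2 fun z => (hb z).continuousAt
  have hU := continuous_uSq n f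
  have hT : IsWirtingerTest R (fun z => (η (uSq n f z) : ℂ))
      (fun z => (e (uSq n f z) : ℂ) * (starRingEnd ℂ) (uSqDbar n f z))
      (fun z => (e (uSq n f z) : ℂ) * uSqDbar n f z) := {
    deriv := fun z => hasFDerivAt_ofReal_comp_uSq n f z (hη _)
    cont_α := (Complex.continuous_ofReal.comp (he.comp hU)).mul
      (Complex.continuous_conj.comp hbc)
    cont_β := (Complex.continuous_ofReal.comp (he.comp hU)).mul hbc
    zero := fun z hz => by simp [hη0 _ (hR z hz)]
    zero_α := fun z hz => by simp [he0 _ (hR z hz)]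
    zero_β := fun z hz => by simp [he0 _ (hR z hz)] }
  have h1 := norm_variance_le hT
  have c1 : ∫ z, (η (uSq n f z) : ℂ) ^ 2 / onePlus z ^ 2 =
      ((∫ z, η (uSq n f z) ^ 2 / (1 + ‖z‖ ^ 2) ^ 2 : ℝ) : ℂ) := by
    rw [← integral_complex_ofReal]
    congr 1; ext z; rw [onePlus_eq]; push_cast; rfl
  have c2 : ∫ z, (η (uSq n f z) : ℂ) / onePlus z ^ 2 =
      ((∫ z, η (uSq n f z) / (1 + ‖z‖ ^ 2) ^ 2 : ℝ) : ℂ) := by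
    rw [← integral_complex_ofReal]
    congr 1; ext z; rw [onePlus_eq]; push_cast; rfl
  have c3 : ∀ z, ‖(e (uSq n f z) : ℂ) * uSqDbar n f z‖ = e (uSq n f z) * ‖uSqDbar n f z‖ :=
    fun z => by rw [norm_mul, Complex.norm_real, Real.norm_of_nonneg (he_nn _)]
  simp only [c1, c2, c3] at h1
  rw [← Complex.ofReal_mul, ← Complex.ofReal_pow, ← Complex.ofReal_sub, Complex.norm_real] at h1
  have h2 := (le_abs_self _).trans h1
  have h3 := sq_integral_gradient_le ha hR he he_nn he0
  rw [integral_uSq_energy ha hR hη he hη0 he0] at h3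
  exact h2.trans h3

lemma exists_smooth_cutoff {a b c : ℝ} (hab : a < b) (hc : (b - a)⁻¹ < c) :
    ∃ η e : ℝ → ℝ, (∀ s, HasDerivAt η (e s) s) ∧ Continuous e ∧ (∀ s, 0 ≤ e s) ∧
      (∀ s, e s ≤ c) ∧ (∀ s ≤ a, η s = 0) ∧ (∀ s ≤ a, e s = 0) ∧ (∀ s, b ≤ s → η s = 1) ∧
      (∀ s, b ≤ s → e s = 0) ∧ (∀ s, 0 ≤ η s) ∧ ∀ s, η s ≤ 1 := by
  have hba : 0 < b - a := sub_pos.2 hab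
  have hc0 : 0 < c := (inv_pos.2 hba).trans hc
  have hc' : c⁻¹ < b - a := inv_lt_of_inv_lt₀ hba hc
  set δ := (b - a - c⁻¹) / 2 with hδ
  have hδ0 : 0 < δ := by rw [hδ]; linarith
  set g : ℝ → ℝ := fun s => max 0 (min 1 (min ((s - a) / δ) ((b - s) / δ))) with hg
  have hgc : Continuous g := by fun_prop
  have hg0 : ∀ s, 0 ≤ g s := fun s => le_max_left _ _
  have hg1 : ∀ s, g s ≤ 1 := fun s => max_le zero_le_one (min_le_left _ _)
  have hga : ∀ s ≤ a, g s = 0 := fun s hs => max_eq_left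
    ((min_le_right _ _).trans ((min_le_left _ _).trans
      (div_nonpos_of_nonpos_of_nonneg (by linarith) hδ0.le)))
  have hgb : ∀ s, b ≤ s → g s = 0 := fun s hs => max_eq_left
    ((min_le_right _ _).trans ((min_le_right _ _).trans
      (div_nonpos_of_nonpos_of_nonneg (by linarith) hδ0.le)))
  have hgm : ∀ s, a + δ ≤ s → s ≤ b - δ → 1 ≤ g s := fun s h1 h2 => by
    refine le_max_of_le_right (le_min le_rfl (le_min ?_ ?_)) <;> rw [le_div_iff₀ hδ0] <;> linarith
  have hgi : ∀ x y, IntervalIntegrable g volume x y := fun x y => hgc.intervalIntegrable x y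
  set Z := ∫ s in a..b, g s with hZ
  have hcpos := inv_pos.2 hc0
  have hZc : c⁻¹ ≤ Z := by
    have e1 : Z = (∫ s in a..(a + δ), g s) + (∫ s in (a + δ)..(b - δ), g s) +
        ∫ s in (b - δ)..b, g s := by
      rw [intervalIntegral.integral_add_adjacent_intervals (hgi _ _) (hgi _ _),
        intervalIntegral.integral_add_adjacent_intervals (hgi _ _) (hgi _ _)]
    have e2 : 0 ≤ ∫ s in a..(a + δ), g s :=
      intervalIntegral.integral_nonneg (by linarith) fun s _ => hg0 s
    have e3 : 0 ≤ ∫ s in (b - δ)..b, g s :=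
      intervalIntegral.integral_nonneg (by linarith) fun s _ => hg0 s
    have e4 : ∫ s in (a + δ)..(b - δ), (1 : ℝ) ≤ ∫ s in (a + δ)..(b - δ), g s :=
      intervalIntegral.integral_mono_on (by linarith) intervalIntegrable_const (hgi _ _)
        fun s hs => hgm s hs.1 hs.2
    rw [intervalIntegral.integral_const, smul_eq_mul, mul_one] at e4
    linarith
  have hZ0 : 0 < Z := hcpos.trans_le hZc
  have hder : ∀ s, HasDerivAt (fun s => Z⁻¹ * ∫ t in a..s, g t) (Z⁻¹ * g s) s := fun s =>
    (intervalIntegral.integral_hasDerivAt_right (hgi _ _)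
      hgc.aestronglyMeasurable.stronglyMeasurableAtFilter hgc.continuousAt).const_mul _
  have hea : ∀ s ≤ a, Z⁻¹ * ∫ t in a..s, g t = 0 := fun s hs => by
    have : ∫ t in a..s, g t = ∫ t in a..s, (0 : ℝ) := by
      apply intervalIntegral.integral_congr
      intro t ht
      rw [Set.uIcc_of_ge hs] at ht
      exact hga t ht.2
    rw [this]; simp
  have heb : ∀ s, b ≤ s → Z⁻¹ * ∫ t in a..s, g t = 1 := fun s hs => by
    have : ∫ t in b..s, g t = ∫ t in b..s, (0 : ℝ) := by
      apply intervalIntegral.integral_congr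
      intro t ht
      rw [Set.uIcc_of_le hs] at ht
      exact hgb t ht.1
    rw [← intervalIntegral.integral_add_adjacent_intervals (hgi a b) (hgi b s), this]
    simp only [intervalIntegral.integral_zero, add_zero]
    exact inv_mul_cancel₀ hZ0.ne'
  have hnn : ∀ s, 0 ≤ Z⁻¹ * g s := fun s => mul_nonneg (inv_pos.2 hZ0).le (hg0 s)
  have hmono : Monotone fun s => Z⁻¹ * ∫ t in a..s, g t :=
    monotone_of_deriv_nonneg (fun s => (hder s).differentiableAt) fun s => by
      rw [(hder s).deriv]; exact hnn s
  refine ⟨_, _, hder, by fun_prop, hnn, fun s => ?_, hea, fun s hs => by simp [hga s hs], heb,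
    fun s hs => by simp [hgb s hs], fun s => ?_, fun s => ?_⟩
  · calc Z⁻¹ * g s ≤ Z⁻¹ * 1 := by gcongr; exact hg1 s
      _ ≤ c := by rw [mul_one]; exact inv_le_of_inv_le₀ hc0 hZc
  · have := hmono (min_le_left s a)
    simp only [hea _ (min_le_right s a)] at this
    exact this
  · have := hmono (le_max_left s b)
    simp only [heb _ (le_max_right s b)] at this
    exact this

/-- The density of the normalized area of the Riemann sphere in the stereographic chart. -/
noncomputable def sphereDensity (z : ℂ) : ℝ := Real.pi⁻¹ * ((1 + ‖z‖ ^ 2) ^ 2)⁻¹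

lemma sphereDensity_pos (z : ℂ) : 0 < sphereDensity z := by
  have := Real.pi_pos
  unfold sphereDensity; positivity

lemma continuous_sphereDensity : Continuous sphereDensity := by
  unfold sphereDensity
  fun_prop (disch := intro z; positivity)

lemma integrable_sphereDensity : Integrable sphereDensity := by
  have h := integrable_rpow_neg_one_add_norm_sq (E := ℂ) (μ := volume) (r := 4)
    (by simp; norm_num)
  refine (h.const_mul Real.pi⁻¹).congr (Filter.Eventually.of_forall fun z => ?_)
  have : (-4 / 2 : ℝ) = -(2 : ℕ) := by norm_num
  simp only [sphereDensity, this]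
  rw [Real.rpow_neg (by positivity), Real.rpow_natCast]

lemma integral_div_eq_sphereDensity (F : ℂ → ℝ) :
    ∫ z, F z / (1 + ‖z‖ ^ 2) ^ 2 = Real.pi * ∫ z, F z * sphereDensity z := by
  rw [← integral_const_mul]
  congr 1; ext z
  have := Real.pi_pos
  unfold sphereDensity
  field_simp

/-- The mass of the superlevel sets of `uSq`. -/
noncomputable def muSq (n : ℕ) (f : Polynomial ℂ) (s : ℝ) : ℝ :=
  ∫ z in {z : ℂ | s < uSq n f z}, sphereDensity z

lemma muSq_anti (n : ℕ) (f : Polynomial ℂ) : Antitone (muSq n f) := fun _ t hst =>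
  setIntegral_mono_set integrable_sphereDensity.integrableOn
    (Filter.Eventually.of_forall fun z => (sphereDensity_pos z).le)
    (Filter.Eventually.of_forall fun _ (hz : t < _) => hst.trans_lt hz)

lemma muSq_sub_sq_le {n : ℕ} {f : Polynomial ℂ} {a b c R : ℝ} (ha : 0 < a)
    (hR : ∀ z, R < ‖z‖ → uSq n f z ≤ a) (hab : a < b) (hc : (b - a)⁻¹ < c) :
    muSq n f b - muSq n f a ^ 2 ≤ n * muSq n f a * (c * b * (muSq n f a - muSq n f b)) := by
  obtain ⟨η, e, hη, he, he_nn, hec, hηa, hea, hηb, heb, hη0, hη1⟩ := exists_smooth_cutoff hab hc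
  have hU := continuous_uSq n f
  have hρ := continuous_sphereDensity
  have hηc : Continuous η := continuous_iff_continuousAt.2 fun s => (hη s).continuousAt
  have hc0 : 0 < c := (inv_pos.2 (sub_pos.2 hab)).trans hc
  have hms : ∀ s, MeasurableSet {z : ℂ | s < uSq n f z} := fun s =>
    (isOpen_lt continuous_const hU).measurableSet
  have hmu : ∀ s, muSq n f s = ∫ z, Set.indicator {z : ℂ | s < uSq n f z} sphereDensity z :=
    fun s => (integral_indicator (hms s)).symm
  have hi : ∀ s, Integrable (Set.indicator {z : ℂ | s < uSq n f z} sphereDensity) := fun s =>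
    integrable_sphereDensity.indicator (hms s)
  have i1 : Integrable fun z => η (uSq n f z) * sphereDensity z := by
    apply integrable_of_norm_lt (R := R) (by fun_prop)
    intro z hz; simp [hηa _ (hR z hz)]
  have i2 : Integrable fun z => η (uSq n f z) ^ 2 * sphereDensity z := by
    apply integrable_of_norm_lt (R := R) (by fun_prop)
    intro z hz; simp [hηa _ (hR z hz)]
  have i3 : Integrable fun z => e (uSq n f z) * uSq n f z * sphereDensity z := by
    apply integrable_of_norm_lt (R := R) (by fun_prop)
    intro z hz; simp [hea _ (hR z hz)]
  have key := variance_uSq_le ha hR hη he he_nn hηa hea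
  simp only [integral_div_eq_sphereDensity] at key
  have hB : muSq n f b ≤ ∫ z, η (uSq n f z) ^ 2 * sphereDensity z := by
    rw [hmu]
    refine integral_mono (hi _) i2 fun z => ?_
    have := sphereDensity_pos z
    by_cases hz : b < uSq n f z
    · simp [Set.indicator_of_mem (show z ∈ {z : ℂ | b < uSq n f z} from hz), hηb _ hz.le]
    · simp only [Set.indicator_of_notMem (show z ∉ {z : ℂ | b < uSq n f z} from hz)]
      positivity
  have hA : ∫ z, η (uSq n f z) * sphereDensity z ≤ muSq n f a := by
    rw [hmu]
    refine integral_mono i1 (hi _) fun z => ?_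
    have := sphereDensity_pos z
    by_cases hz : a < uSq n f z
    · simp only [Set.indicator_of_mem (show z ∈ {z : ℂ | a < uSq n f z} from hz)]
      exact mul_le_of_le_one_left this.le (hη1 _)
    · simp [Set.indicator_of_notMem (show z ∉ {z : ℂ | a < uSq n f z} from hz), hηa _ (not_lt.1 hz)]
  have hE : ∫ z, e (uSq n f z) * uSq n f z * sphereDensity z ≤
      c * b * (muSq n f a - muSq n f b) := by
    rw [hmu, hmu, ← integral_sub (hi _) (hi _), ← integral_const_mul]
    refine integral_mono i3 (((hi _).sub (hi _)).const_mul _) fun z => ?_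
    have := sphereDensity_pos z
    by_cases hz : a < uSq n f z
    · by_cases hz' : b < uSq n f z
      · simp [Set.indicator_of_mem (show z ∈ {z : ℂ | a < uSq n f z} from hz),
          Set.indicator_of_mem (show z ∈ {z : ℂ | b < uSq n f z} from hz'), heb _ hz'.le]
      · simp only [Set.indicator_of_mem (show z ∈ {z : ℂ | a < uSq n f z} from hz),
          Set.indicator_of_notMem (show z ∉ {z : ℂ | b < uSq n f z} from hz'), sub_zero]
        have := uSq_nonneg n f z
        have := hec (uSq n f z)
        have := not_lt.1 hz'
        gcongr
    · have hz' : ¬ b < uSq n f z := fun h => hz (hab.trans h)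
      simp [Set.indicator_of_notMem (show z ∉ {z : ℂ | a < uSq n f z} from hz),
        Set.indicator_of_notMem (show z ∉ {z : ℂ | b < uSq n f z} from hz'), hea _ (not_lt.1 hz)]
  have hp0 : 0 ≤ ∫ z, η (uSq n f z) * sphereDensity z :=
    integral_nonneg fun z => mul_nonneg (hη0 _) (sphereDensity_pos z).le
  have hE0 : 0 ≤ ∫ z, e (uSq n f z) * uSq n f z * sphereDensity z :=
    integral_nonneg fun z => mul_nonneg (mul_nonneg (he_nn _) (uSq_nonneg n f z))
      (sphereDensity_pos z).le
  have hA0 := hp0.trans hA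
  have hπ := Real.pi_pos
  have key' : (∫ z, η (uSq n f z) ^ 2 * sphereDensity z) -
      (∫ z, η (uSq n f z) * sphereDensity z) ^ 2 ≤
      n * (∫ z, η (uSq n f z) * sphereDensity z) *
        ∫ z, e (uSq n f z) * uSq n f z * sphereDensity z := by
    refine le_of_mul_le_mul_left ?_ (pow_pos hπ 2)
    linarith
  calc muSq n f b - muSq n f a ^ 2 ≤ (∫ z, η (uSq n f z) ^ 2 * sphereDensity z) -
      (∫ z, η (uSq n f z) * sphereDensity z) ^ 2 := by gcongr
    _ ≤ _ := key'
    _ ≤ _ := by gcongr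

lemma one_sub_muSq_le {n : ℕ} {f : Polynomial ℂ} {a b m R : ℝ} (ha : 0 < a)
    (hR : ∀ z, R < ‖z‖ → uSq n f z ≤ a) (hab : a < b) (hm : 0 < m) (hma : m ≤ muSq n f a) :
    1 - muSq n f a ≤ (n * (b / (b - a)) + m⁻¹) * (muSq n f a - muSq n f b) := by
  set A := muSq n f a
  set B := muSq n f b
  have hAB : B ≤ A := muSq_anti n f hab.le
  have h1 : B - A ^ 2 ≤ n * A * ((b - a)⁻¹ * b * (A - B)) := by
    have hlim : Filter.Tendsto (fun c : ℝ => n * A * (c * b * (A - B)))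
        (nhdsWithin (b - a)⁻¹ (Set.Ioi (b - a)⁻¹)) (nhds (n * A * ((b - a)⁻¹ * b * (A - B)))) :=
      (Continuous.tendsto (by fun_prop) _).mono_left nhdsWithin_le_nhds
    refine ge_of_tendsto hlim ?_
    filter_upwards [self_mem_nhdsWithin] with c hc
    exact muSq_sub_sq_le ha hR hab hc
  have hA : 0 < A := hm.trans_le hma
  have h2 : 1 ≤ m⁻¹ * A := by rw [inv_mul_eq_div, one_le_div hm]; exact hma
  have h3 : (A - B) ≤ m⁻¹ * A * (A - B) := le_mul_of_one_le_left (sub_nonneg.2 hAB) h2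
  refine le_of_mul_le_mul_left ?_ hA
  rw [div_eq_mul_inv]
  nlinarith

lemma mul_rpow_le_of_step {D : ℝ → ℝ} {n K s t : ℝ} (hn : 0 < n) (hK : 0 ≤ K) (hs : 0 < s)
    (hst : s < t) (H : ∀ a b, s ≤ a → a < b → b ≤ t →
      D a ≤ (n * (b / (b - a)) + K) * (D b - D a)) :
    D s * (t / s) ^ n⁻¹ ≤ D t := by
  have ht : 0 < t := hs.trans hst
  set L := Real.log (t / s) with hL
  have hL0 : 0 < L := Real.log_pos ((one_lt_div hs).2 hst)
  set q : ℕ → ℝ := fun k => Real.exp (L / k) with hq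
  set x : ℕ → ℝ := fun k => (q k - 1) / (n * q k + K * (q k - 1)) with hx
  have hq1 : ∀ k : ℕ, 0 < k → 1 < q k := fun k hk =>
    Real.one_lt_exp_iff.2 (div_pos hL0 (Nat.cast_pos.2 hk))
  have hqk : ∀ k : ℕ, 0 < k → q k ^ k = t / s := fun k hk => by
    have : (k : ℝ) ≠ 0 := (Nat.cast_pos.2 hk).ne'
    rw [hq]; simp only
    rw [← Real.exp_nat_mul, mul_div_cancel₀ _ this, hL, Real.exp_log (div_pos ht hs)]
  have hx0 : ∀ k : ℕ, 0 < k → 0 ≤ x k := fun k hk => by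
    have := hq1 k hk
    exact div_nonneg (by linarith) (add_nonneg (by positivity) (mul_nonneg hK (by linarith)))
  have hiter : ∀ k : ℕ, 0 < k → ∀ j ≤ k, D s * (1 + x k) ^ j ≤ D (s * q k ^ j) := by
    intro k hk j
    have hqk1 := hq1 k hk
    have hx0k := hx0 k hk
    induction j with
    | zero => simp
    | succ j ih =>
      intro hj
      have ih := ih (by omega)
      have hpj : 1 ≤ q k ^ j := one_le_pow₀ hqk1.le
      have hle : q k ^ (j + 1) ≤ t / s := by
        rw [← hqk k hk]; exact pow_le_pow_right₀ hqk1.le hj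
      have hab : s * q k ^ j < s * q k ^ (j + 1) := by
        rw [pow_succ]; gcongr; nlinarith
      have h := H (s * q k ^ j) (s * q k ^ (j + 1)) (by nlinarith) hab (by
        rw [le_div_iff₀ hs] at hle; linarith)
      have hratio : s * q k ^ (j + 1) / (s * q k ^ (j + 1) - s * q k ^ j) = q k / (q k - 1) := by
        have h1 : q k - 1 ≠ 0 := by linarith
        have h2 : s * q k ^ j ≠ 0 := by positivity
        have h3 : s * q k ^ (j + 1) - s * q k ^ j = s * q k ^ j * (q k - 1) := by ring
        have h4 : s * q k ^ (j + 1) = s * q k ^ j * q k := by ring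
        rw [h3, h4, mul_div_mul_left _ _ h2]
      rw [hratio] at h
      have hden : 0 < n * q k + K * (q k - 1) :=
        add_pos_of_pos_of_nonneg (by positivity) (mul_nonneg hK (by linarith))
      have hc : (n * (q k / (q k - 1)) + K) * x k = 1 := by
        have h1 : q k - 1 ≠ 0 := by linarith
        have h2 : n * q k + (q k - 1) * K ≠ 0 := by linarith
        rw [hx]; simp only
        field_simp
      have h5 := mul_le_mul_of_nonneg_left h hx0k
      rw [← mul_assoc, mul_comm (x k) (_ + K), hc, one_mul] at h5
      calc D s * (1 + x k) ^ (j + 1) = D s * (1 + x k) ^ j * (1 + x k) := by ring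
        _ ≤ D (s * q k ^ j) * (1 + x k) := by gcongr
        _ ≤ _ := by linarith
  have hfin : ∀ k : ℕ, 0 < k → D s * (1 + x k) ^ k ≤ D t := fun k hk => by
    have := hiter k hk k le_rfl
    rwa [hqk k hk, mul_div_cancel₀ _ hs.ne'] at this
  have hLk : Filter.Tendsto (fun k : ℕ => L / (k : ℝ)) Filter.atTop (nhds 0) :=
    tendsto_const_div_atTop_nhds_zero_nat L
  have hq_lim : Filter.Tendsto q Filter.atTop (nhds 1) := by
    have := (Real.continuous_exp.tendsto 0).comp hLk
    rwa [Real.exp_zero] at this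
  have hslope : Filter.Tendsto (fun k : ℕ => (k : ℝ) * (q k - 1)) Filter.atTop (nhds L) := by
    have h1 := (hasDerivAt_iff_tendsto_slope_zero.1 (Real.hasDerivAt_exp 0))
    have h2 : Filter.Tendsto (fun k : ℕ => L / (k : ℝ)) Filter.atTop
        (nhdsWithin 0 {0}ᶜ) := by
      refine tendsto_nhdsWithin_iff.2 ⟨hLk, ?_⟩
      filter_upwards [Filter.eventually_gt_atTop 0] with k hk
      exact (div_pos hL0 (Nat.cast_pos.2 hk)).ne'
    have h3 := (h1.comp h2).const_mul L
    rw [Real.exp_zero, mul_one] at h3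
    refine h3.congr' ?_
    filter_upwards [Filter.eventually_gt_atTop 0] with k hk
    have : (k : ℝ) ≠ 0 := (Nat.cast_pos.2 hk).ne'
    simp only [Function.comp, zero_add, smul_eq_mul, hq]
    field_simp
  have hkx : Filter.Tendsto (fun k : ℕ => (k : ℝ) * x k) Filter.atTop (nhds (L / n)) := by
    have h1 := hslope.div ((hq_lim.const_mul n).add ((hq_lim.sub_const 1).const_mul K))
      (by simpa using hn.ne')
    simp only [mul_one, sub_self, mul_zero, add_zero] at h1
    refine h1.congr fun k => ?_
    simp only [hx, Pi.div_apply, mul_div_assoc]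
  have hlim := (Real.tendsto_one_add_pow_exp_of_tendsto hkx).const_mul (D s)
  have hexp : Real.exp (L / n) = (t / s) ^ n⁻¹ := by
    rw [Real.rpow_def_of_pos (div_pos ht hs), div_eq_mul_inv]
  rw [← hexp]
  refine le_of_tendsto hlim ?_
  filter_upwards [Filter.eventually_gt_atTop 0] with k hk
  exact hfin k hk

lemma exists_uSq_le_of_norm_gt {n : ℕ} {f : Polynomial ℂ} (hf : f.natDegree < n) {a : ℝ}
    (ha : 0 < a) : ∃ R, ∀ z, R < ‖z‖ → uSq n f z ≤ a := by
  set C := ∑ i ∈ Finset.range n, ‖f.coeff i‖ with hC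
  have hC0 : 0 ≤ C := Finset.sum_nonneg fun i _ => norm_nonneg _
  refine ⟨max 1 (C ^ 2 / a), fun z hz => ?_⟩
  have h1 : 1 < ‖z‖ := (le_max_left _ _).trans_lt hz
  have h2 : C ^ 2 / a < ‖z‖ := (le_max_right _ _).trans_lt hz
  have hz0 : 0 < ‖z‖ := one_pos.trans h1
  have hb : ‖f.eval z‖ * ‖z‖ ≤ C * ‖z‖ ^ n := by
    rw [Polynomial.eval_eq_sum_range' hf, hC, Finset.sum_mul, ← norm_mul, Finset.sum_mul]
    refine (norm_sum_le _ _).trans (Finset.sum_le_sum fun i hi => ?_)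
    rw [norm_mul, norm_mul, norm_pow, mul_assoc, ← pow_succ]
    gcongr
    · exact h1.le
    · exact Finset.mem_range.1 hi
  rw [uSq, div_le_iff₀ (by positivity)]
  rw [div_lt_iff₀ ha] at h2
  have h3 : (‖f.eval z‖ * ‖z‖) ^ 2 ≤ (C * ‖z‖ ^ n) ^ 2 := by gcongr
  have h4 : (‖z‖ ^ 2) ^ n ≤ (1 + ‖z‖ ^ 2) ^ n := by gcongr; linarith
  have h5 : (‖f.eval z‖ ^ 2) * ‖z‖ ^ 2 ≤ a * (1 + ‖z‖ ^ 2) ^ n * ‖z‖ ^ 2 := by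
    calc (‖f.eval z‖ ^ 2) * ‖z‖ ^ 2 = (‖f.eval z‖ * ‖z‖) ^ 2 := by ring
      _ ≤ (C * ‖z‖ ^ n) ^ 2 := h3
      _ = C ^ 2 * (‖z‖ ^ 2) ^ n := by ring
      _ ≤ (a * ‖z‖ ^ 2) * (1 + ‖z‖ ^ 2) ^ n := by
        gcongr
        nlinarith
      _ = _ := by ring
  exact le_of_mul_le_mul_right h5 (by positivity)

lemma one_sub_muSq_mul_rpow_le {n : ℕ} {f : Polynomial ℂ} (hf : f.natDegree < n) {s t : ℝ}
    (hs : 0 < s) (hst : s < t) (ht : 0 < muSq n f t) :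
    (1 - muSq n f s) * (t / s) ^ (n : ℝ)⁻¹ ≤ 1 - muSq n f t := by
  refine mul_rpow_le_of_step (D := fun s => 1 - muSq n f s) (K := (muSq n f t)⁻¹)
    (Nat.cast_pos.2 (by omega)) (inv_pos.2 ht).le hs hst fun a b ha hab hb => ?_
  have ha0 := hs.trans_le ha
  obtain ⟨R, hR⟩ := exists_uSq_le_of_norm_gt hf ha0
  have := one_sub_muSq_le ha0 hR hab ht (muSq_anti n f (hab.le.trans hb))
  simpa using this

/-- The rotation of the Riemann sphere sending `∞` to `w`, in the stereographic chart. -/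
noncomputable def sphereRot (w z : ℂ) : ℂ := (w * z - 1) / (z + (starRingEnd ℂ) w)

lemma add_conj_ne_zero {w z : ℂ} (hz : z ≠ -(starRingEnd ℂ) w) : z + (starRingEnd ℂ) w ≠ 0 :=
  fun h => hz (eq_neg_of_add_eq_zero_left h)

lemma one_add_normSq_sphereRot {w z : ℂ} (hz : z ≠ -(starRingEnd ℂ) w) :
    1 + ‖sphereRot w z‖ ^ 2 =
      (1 + ‖w‖ ^ 2) * (1 + ‖z‖ ^ 2) / ‖z + (starRingEnd ℂ) w‖ ^ 2 := by
  have h0 : ‖z + (starRingEnd ℂ) w‖ ^ 2 ≠ 0 := pow_ne_zero _ (norm_ne_zero_iff.2 (add_conj_ne_zero hz))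
  rw [sphereRot, norm_div, div_pow, eq_div_iff h0, add_mul, div_mul_cancel₀ _ h0]
  simp only [← Complex.normSq_eq_norm_sq, Complex.normSq_apply, Complex.add_re, Complex.add_im,
    Complex.sub_re, Complex.sub_im, Complex.mul_re, Complex.mul_im, Complex.conj_re,
    Complex.conj_im, Complex.one_re, Complex.one_im]
  ring

lemma hasDerivAt_sphereRot {w z : ℂ} (hz : z ≠ -(starRingEnd ℂ) w) :
    HasDerivAt (sphereRot w) (onePlus w / (z + (starRingEnd ℂ) w) ^ 2) z := by
  have h := ((((hasDerivAt_id z).const_mul w).sub_const 1).div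
    ((hasDerivAt_id z).add_const ((starRingEnd ℂ) w)) (add_conj_ne_zero hz))
  refine h.congr_deriv ?_
  simp only [onePlus, id]
  ring

lemma sphereRot_injOn (w : ℂ) : Set.InjOn (sphereRot w) {-(starRingEnd ℂ) w}ᶜ := by
  intro z hz z' hz' h
  have h1 := add_conj_ne_zero hz
  have h2 := add_conj_ne_zero hz'
  rw [sphereRot, sphereRot, div_eq_div_iff h1 h2] at h
  have h3 : onePlus w * (z - z') = 0 := by rw [onePlus]; linear_combination h
  exact sub_eq_zero.1 ((mul_eq_zero.1 h3).resolve_left (onePlus_ne_zero w))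

lemma image_sphereRot {w : ℂ} {S T : Set ℂ}
    (h : ∀ z, z ≠ -(starRingEnd ℂ) w → (z ∈ T ↔ sphereRot w z ∈ S)) :
    sphereRot w '' (T \ {-(starRingEnd ℂ) w}) = S \ {w} := by
  have hw := onePlus_ne_zero w
  ext u
  constructor
  · rintro ⟨z, ⟨hzT, hz⟩, rfl⟩
    refine ⟨(h z hz).1 hzT, fun hu => ?_⟩
    have hu : (w * z - 1) / (z + (starRingEnd ℂ) w) = w := hu
    rw [div_eq_iff (add_conj_ne_zero hz)] at hu
    exact hw (by rw [onePlus]; linear_combination -hu)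
  · rintro ⟨huS, hu⟩
    have hwu : w - u ≠ 0 := sub_ne_zero.2 fun h => hu h.symm
    have e1 : (1 + u * (starRingEnd ℂ) w) / (w - u) + (starRingEnd ℂ) w =
        onePlus w / (w - u) := by
      rw [onePlus]; field_simp; ring
    have hz : (1 + u * (starRingEnd ℂ) w) / (w - u) ≠ -(starRingEnd ℂ) w := fun hz =>
      div_ne_zero hw hwu (by rw [← e1, hz]; ring)
    have hR : sphereRot w ((1 + u * (starRingEnd ℂ) w) / (w - u)) = u := by
      rw [sphereRot, e1, div_eq_iff (div_ne_zero hw hwu), onePlus]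
      field_simp
      ring
    exact ⟨_, ⟨(h _ hz).2 (by rwa [hR]), hz⟩, hR⟩

lemma setIntegral_sphereDensity_eq {w : ℂ} {S T : Set ℂ} (hT : MeasurableSet T)
    (h : ∀ z, z ≠ -(starRingEnd ℂ) w → (z ∈ T ↔ sphereRot w z ∈ S)) :
    ∫ z in T, sphereDensity z = ∫ z in S, sphereDensity z := by
  have hdiff : ∀ (A : Set ℂ) (x : ℂ),
      ∫ z in A \ {x}, sphereDensity z = ∫ z in A, sphereDensity z := fun A x =>
    setIntegral_congr_set (sdiff_null_ae_eq_self (by simp))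
  rw [← hdiff S w, ← hdiff T (-(starRingEnd ℂ) w), ← image_sphereRot h,
    integral_image_eq_integral_abs_det_fderiv_smul volume
      (hT.diff (measurableSet_singleton _))
      (fun z hz => ((hasDerivAt_sphereRot hz.2).hasFDerivAt.restrictScalars ℝ).hasFDerivWithinAt)
      ((sphereRot_injOn w).mono fun z hz => hz.2)]
  refine setIntegral_congr_fun (hT.diff (measurableSet_singleton _)) fun z hz => ?_
  have h0 : ‖z + (starRingEnd ℂ) w‖ ≠ 0 := norm_ne_zero_iff.2 (add_conj_ne_zero hz.2)
  have hπ := Real.pi_pos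
  have hdet : ∀ c : ℂ, ((ContinuousLinearMap.toSpanSingleton ℂ c).restrictScalars ℝ).det =
      ‖c‖ ^ 2 := fun c => by
    simp [ContinuousLinearMap.det, LinearMap.det_restrictScalars, Algebra.norm_complex_eq,
      Complex.normSq_eq_norm_sq]
  rw [hdet, abs_of_nonneg (sq_nonneg _), smul_eq_mul, sphereDensity, sphereDensity,
    one_add_normSq_sphereRot hz.2, norm_div, norm_pow, norm_onePlus]
  field_simp

lemma exists_rotated_polynomial {n : ℕ} {f : Polynomial ℂ} (hf : f.natDegree ≤ n) (hn : 1 ≤ n)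
    {w : ℂ} (hw : f.eval w = 0) : ∃ g : Polynomial ℂ, g.natDegree < n ∧
      ∀ z, z ≠ -(starRingEnd ℂ) w → uSq n g z = uSq n f (sphereRot w z) := by
  set P : Polynomial ℂ := Polynomial.C w * Polynomial.X - 1 with hP
  set Q : Polynomial ℂ := Polynomial.X + Polynomial.C ((starRingEnd ℂ) w) with hQ
  have hPd : P.natDegree ≤ 1 := by rw [hP]; compute_degree
  have hQd : Q.natDegree ≤ 1 := by rw [hQ]; compute_degree
  have hP1 : P.coeff 1 = w := by simp [hP, Polynomial.coeff_one]
  have hQ1 : Q.coeff 1 = 1 := by simp [hQ]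
  set g₀ : Polynomial ℂ :=
    ∑ j ∈ Finset.range (n + 1), Polynomial.C (f.coeff j) * (P ^ j * Q ^ (n - j)) with hg₀
  have hPj : ∀ j, (P ^ j).natDegree ≤ j := fun j => by
    simpa using Polynomial.natDegree_pow_le_of_le j hPd
  have hQj : ∀ j, (Q ^ j).natDegree ≤ j := fun j => by
    simpa using Polynomial.natDegree_pow_le_of_le j hQd
  have hd : g₀.natDegree ≤ n := by
    refine Polynomial.natDegree_sum_le_of_forall_le _ _ fun j hj => ?_
    have hj : j ≤ n := Nat.lt_succ_iff.1 (Finset.mem_range.1 hj)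
    refine (Polynomial.natDegree_C_mul_le _ _).trans ?_
    refine (Polynomial.natDegree_mul_le_of_le (hPj j) (hQj (n - j))).trans (by omega)
  have hc : g₀.coeff n = 0 := by
    rw [hg₀, Polynomial.finsetSum_coeff, ← hw,
      Polynomial.eval_eq_sum_range' (Nat.lt_succ_of_le hf)]
    refine Finset.sum_congr rfl fun j hj => ?_
    have hj : j ≤ n := Nat.lt_succ_iff.1 (Finset.mem_range.1 hj)
    have h1 : (P ^ j).coeff j = w ^ j := by
      have := Polynomial.coeff_pow_of_natDegree_le (m := j) hPd
      rwa [mul_one, hP1] at this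
    have h2 : (Q ^ (n - j)).coeff (n - j) = 1 := by
      have := Polynomial.coeff_pow_of_natDegree_le (m := n - j) hQd
      rwa [mul_one, hQ1, one_pow] at this
    have h3 := Polynomial.coeff_mul_add_eq_of_natDegree_le (hPj j) (hQj (n - j))
    rw [Nat.add_sub_cancel' hj, h1, h2, mul_one] at h3
    rw [Polynomial.coeff_C_mul, h3]
  have hlt : g₀.natDegree < n := by
    refine lt_of_le_of_ne hd fun h => ?_
    rw [← h, Polynomial.coeff_natDegree, Polynomial.leadingCoeff_eq_zero] at hc
    rw [hc, Polynomial.natDegree_zero] at h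
    omega
  refine ⟨Polynomial.C (((Real.sqrt (1 + ‖w‖ ^ 2))⁻¹ ^ n : ℝ) : ℂ) * g₀,
    (Polynomial.natDegree_C_mul_le _ _).trans_lt hlt, fun z hz => ?_⟩
  have h0 := add_conj_ne_zero hz
  have hev : g₀.eval z = (z + (starRingEnd ℂ) w) ^ n * f.eval (sphereRot w z) := by
    rw [hg₀, Polynomial.eval_finsetSum, Polynomial.eval_eq_sum_range' (Nat.lt_succ_of_le hf),
      Finset.mul_sum]
    refine Finset.sum_congr rfl fun j hj => ?_
    have hj : j ≤ n := Nat.lt_succ_iff.1 (Finset.mem_range.1 hj)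
    obtain ⟨k, rfl⟩ := Nat.exists_eq_add_of_le hj
    simp only [Polynomial.eval_mul, Polynomial.eval_C, Polynomial.eval_pow, hP, hQ,
      Polynomial.eval_sub, Polynomial.eval_add, Polynomial.eval_X, Polynomial.eval_one,
      Nat.add_sub_cancel_left, sphereRot, div_pow]
    field_simp
    ring
  have hs : Real.sqrt (1 + ‖w‖ ^ 2) ^ 2 = 1 + ‖w‖ ^ 2 := Real.sq_sqrt (by positivity)
  have h0' : ‖z + (starRingEnd ℂ) w‖ ≠ 0 := norm_ne_zero_iff.2 h0
  rw [uSq, uSq, one_add_normSq_sphereRot hz, Polynomial.eval_mul, Polynomial.eval_C, hev,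
    norm_mul, norm_mul, norm_pow, Complex.norm_real, Real.norm_of_nonneg (by positivity),
    mul_pow, mul_pow, ← pow_mul, mul_comm n 2, pow_mul, ← pow_mul _ n 2, mul_comm n 2, pow_mul,
    inv_pow, hs, div_pow, mul_pow, inv_pow]
  field_simp

lemma exists_natDegree_lt_muSq_eq {n : ℕ} {f : Polynomial ℂ} (hf : f.natDegree ≤ n)
    (hn : 1 ≤ n) : ∃ g : Polynomial ℂ, g.natDegree < n ∧ ∀ s, muSq n g s = muSq n f s := by
  rcases Nat.eq_zero_or_pos f.natDegree with h0 | h0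
  · exact ⟨f, by omega, fun s => rfl⟩
  · obtain ⟨w, hw⟩ := Complex.exists_root (f := f) (Polynomial.natDegree_pos_iff_degree_pos.1 h0)
    obtain ⟨g, hg, hgf⟩ := exists_rotated_polynomial hf hn hw
    refine ⟨g, hg, fun s => setIntegral_sphereDensity_eq (w := w)
      (isOpen_lt continuous_const (continuous_uSq n g)).measurableSet fun z hz => ?_⟩
    simp only [Set.mem_ofPred_eq, hgf z hz]

lemma setIntegral_ball_sphereDensity {r : ℝ} (hr : 0 ≤ r) :
    ∫ z in {z : ℂ | ‖z‖ < r}, sphereDensity z = 1 - (1 + r ^ 2)⁻¹ := by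
  have hm : MeasurableSet {z : ℂ | ‖z‖ < r} := (isOpen_lt continuous_norm continuous_const).measurableSet
  set G : ℝ → ℝ := Set.indicator (Set.Iio r) fun y => Real.pi⁻¹ * ((1 + y ^ 2) ^ 2)⁻¹ with hG
  have hder : ∀ y : ℝ, HasDerivAt (fun y : ℝ => -(2 : ℝ)⁻¹ * (1 + y ^ 2)⁻¹) (y * ((1 + y ^ 2) ^ 2)⁻¹) y := by
    intro y
    have h1 : (1 + y ^ 2) ≠ 0 := by positivity
    refine (((((hasDerivAt_id y).pow 2).const_add 1).inv h1).const_mul _).congr_deriv ?_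
    simp only [id, Pi.pow_apply]
    field_simp
    ring
  have hc : Continuous fun y : ℝ => y * ((1 + y ^ 2) ^ 2)⁻¹ := by
    fun_prop (disch := intro z; positivity)
  have hI : ∫ y in (0 : ℝ)..r, y * ((1 + y ^ 2) ^ 2)⁻¹ = 2⁻¹ * (1 - (1 + r ^ 2)⁻¹) := by
    rw [intervalIntegral.integral_eq_sub_of_hasDerivAt (fun y _ => hder y)
      (hc.intervalIntegrable _ _)]
    ring
  have hJ : ∫ y in Set.Ioi (0 : ℝ), y ^ (2 - 1) • G y =
      Real.pi⁻¹ * (2⁻¹ * (1 - (1 + r ^ 2)⁻¹)) := by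
    rw [← hI, ← intervalIntegral.integral_const_mul, intervalIntegral.integral_of_le hr,
      integral_Ioc_eq_integral_Ioo, ← Set.Ioi_inter_Iio,
      ← setIntegral_indicator measurableSet_Iio]
    refine setIntegral_congr_fun measurableSet_Ioi fun y _ => ?_
    simp only [hG, smul_eq_mul, Set.indicator_apply]
    split_ifs <;> ring
  have key := integral_fun_norm_addHaar (volume : Measure ℂ) G
  rw [Complex.finrank_real_complex, hJ] at key
  rw [← integral_indicator hm]
  have e : ∀ z : ℂ, Set.indicator {z : ℂ | ‖z‖ < r} sphereDensity z = G ‖z‖ := fun z => by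
    simp only [hG, Set.indicator_apply, Set.mem_ofPred_eq, Set.mem_Iio, sphereDensity]
  simp only [e, key]
  have hv : (volume : Measure ℂ).real (Metric.ball 0 1) = Real.pi := by
    simp [Measure.real, Complex.volume_ball]
  rw [hv]
  have := Real.pi_ne_zero
  simp only [nsmul_eq_mul, smul_eq_mul]
  push_cast
  field_simp

lemma uPoly_nonneg (n : ℕ) (f : Polynomial ℂ) (z : ℂ) : 0 ≤ uPoly n f z := by
  unfold uPoly; positivity

lemma uPoly_sq (n : ℕ) (f : Polynomial ℂ) (z : ℂ) : uPoly n f z ^ 2 = uSq n f z := by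
  have h : (0 : ℝ) ≤ 1 + ‖z‖ ^ 2 := by positivity
  have h2 : -(n : ℝ) / 2 * (2 : ℕ) = -(n : ℝ) := by push_cast; ring
  rw [uPoly, uSq, mul_pow, ← Real.rpow_natCast ((1 + ‖z‖ ^ 2) ^ (-(n : ℝ) / 2)) 2,
    ← Real.rpow_mul h, h2, Real.rpow_neg h, Real.rpow_natCast, ← div_eq_mul_inv]

lemma muPoly_eq_muSq (n : ℕ) (f : Polynomial ℂ) {κ : ℝ} (hκ : 0 ≤ κ) :
    muPoly n f κ = muSq n f (κ ^ 2) := by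
  have : {z : ℂ | κ < uPoly n f z} = {z : ℂ | κ ^ 2 < uSq n f z} := by
    ext z
    simp only [Set.mem_ofPred_eq, ← uPoly_sq]
    exact (pow_lt_pow_iff_left₀ hκ (uPoly_nonneg n f z) two_ne_zero).symm
  rw [muPoly, muSq, this]
  rfl

lemma muSq_pos {n : ℕ} {f : Polynomial ℂ} {s : ℝ} (h : ∃ z, s < uSq n f z) : 0 < muSq n f s := by
  have ho : IsOpen {z : ℂ | s < uSq n f z} := isOpen_lt continuous_const (continuous_uSq n f)
  rw [muSq, setIntegral_pos_iff_support_of_nonneg_ae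
    (Filter.Eventually.of_forall fun z => (sphereDensity_pos z).le)
    integrable_sphereDensity.integrableOn]
  have : Function.support sphereDensity = Set.univ :=
    Set.eq_univ_of_forall fun z => (sphereDensity_pos z).ne'
  rw [this, Set.univ_inter]
  exact ho.measure_pos volume h

lemma muSq_sq_pos {n : ℕ} {f : Polynomial ℂ} {κ : ℝ}
    (hκ : κ ∈ Set.Ioo 0 (⨆ z : ℂ, uPoly n f z)) : 0 < muSq n f (κ ^ 2) := by
  obtain ⟨z, hz⟩ := exists_lt_of_lt_ciSup hκ.2
  refine muSq_pos ⟨z, ?_⟩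
  rw [← uPoly_sq]
  exact pow_lt_pow_left₀ hz hκ.1.le two_ne_zero

lemma setIntegral_sphereDensity_inv_pow {n : ℕ} (hn : 1 ≤ n) {s : ℝ} (hs : 0 < s) (hs1 : s < 1) :
    ∫ z in {z : ℂ | s < ((1 + ‖z‖ ^ 2)⁻¹) ^ n}, sphereDensity z = 1 - s ^ (n : ℝ)⁻¹ := by
  have hn0 : n ≠ 0 := by omega
  set t := s ^ (n : ℝ)⁻¹ with ht
  have ht0 : 0 < t := Real.rpow_pos_of_pos hs _
  have htn : t ^ n = s := Real.rpow_inv_natCast_pow hs.le hn0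
  have ht1 : t < 1 := Real.rpow_lt_one hs.le hs1 (by positivity)
  have hinv : 1 < t⁻¹ := (one_lt_inv₀ ht0).2 ht1
  have hr : Real.sqrt (t⁻¹ - 1) ^ 2 = t⁻¹ - 1 := Real.sq_sqrt (by linarith)
  have hset : {z : ℂ | s < ((1 + ‖z‖ ^ 2)⁻¹) ^ n} = {z : ℂ | ‖z‖ < Real.sqrt (t⁻¹ - 1)} := by
    ext z
    simp only [Set.mem_ofPred_eq]
    rw [← htn, pow_lt_pow_iff_left₀ ht0.le (by positivity) hn0, Real.lt_sqrt (norm_nonneg z),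
      lt_inv_comm₀ ht0 (by positivity), lt_sub_iff_add_lt']
  rw [hset, setIntegral_ball_sphereDensity (Real.sqrt_nonneg _), hr, add_sub_cancel, inv_inv]

lemma muSq_of_mem_polyOpt {n : ℕ} {f : Polynomial ℂ} (hf : f ∈ polyOpt n) (s : ℝ) :
    muSq n f s = ∫ z in {z : ℂ | s < ((1 + ‖z‖ ^ 2)⁻¹) ^ n}, sphereDensity z := by
  have hm : MeasurableSet {z : ℂ | s < ((1 + ‖z‖ ^ 2)⁻¹) ^ n} :=
    (isOpen_lt continuous_const (by fun_prop (disch := intro z; positivity))).measurableSet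
  suffices h : (∀ z, uSq n f z = ((1 + ‖z‖ ^ 2)⁻¹) ^ n) ∨ ∃ w, ∀ z, z ≠ -(starRingEnd ℂ) w →
      uSq n f (sphereRot w z) = ((1 + ‖z‖ ^ 2)⁻¹) ^ n by
    rcases h with h | ⟨w, h⟩
    · simp only [muSq, h]
    · refine (setIntegral_sphereDensity_eq hm (w := w) fun z hz => ?_).symm
      simp only [Set.mem_ofPred_eq, h z hz]
  obtain ⟨θ, hf⟩ := hf
  have hθ : ‖Complex.exp (Complex.I * (θ : ℂ))‖ = 1 := by
    rw [mul_comm]; exact Complex.norm_exp_ofReal_mul_I θ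
  rcases hf with ⟨w, hf⟩ | hf
  · have hU : ∀ z, uSq n f z =
        (‖1 + (starRingEnd ℂ) w * z‖ ^ 2 / ((1 + ‖w‖ ^ 2) * (1 + ‖z‖ ^ 2))) ^ n := by
      intro z
      have h0 : (0 : ℝ) ≤ 1 + ‖w‖ ^ 2 := by positivity
      have h1 : ((1 + ‖w‖ ^ 2) ^ ((n : ℝ) / 2)) ^ 2 = (1 + ‖w‖ ^ 2) ^ n := by
        have h2 : (n : ℝ) / 2 * (2 : ℕ) = n := by push_cast; ring
        rw [← Real.rpow_natCast ((1 + ‖w‖ ^ 2) ^ ((n : ℝ) / 2)) 2, ← Real.rpow_mul h0, h2,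
          Real.rpow_natCast]
      rw [uSq, hf, norm_div, norm_mul, hθ, one_mul, norm_pow, Complex.norm_real,
        Real.norm_of_nonneg (by positivity), div_pow, h1, div_pow, mul_pow, div_div,
        ← pow_mul, ← pow_mul, mul_comm n 2]
    rcases eq_or_ne w 0 with rfl | hw
    · left
      intro z
      simp [hU]
    · right
      have hcw : (starRingEnd ℂ) w ≠ 0 := (map_ne_zero _).2 hw
      have hw' : ‖w‖ ≠ 0 := norm_ne_zero_iff.2 hw
      refine ⟨-((starRingEnd ℂ) w)⁻¹, fun z hz => ?_⟩
      have h0 := add_conj_ne_zero hz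
      have h0' := norm_ne_zero_iff.2 h0
      have e1 : 1 + (starRingEnd ℂ) w * sphereRot (-((starRingEnd ℂ) w)⁻¹) z =
          -(onePlus w / w) / (z + (starRingEnd ℂ) (-((starRingEnd ℂ) w)⁻¹)) := by
        rw [sphereRot, eq_div_iff h0, add_mul, mul_assoc, div_mul_cancel₀ _ h0, onePlus]
        simp only [map_neg, map_inv₀, Complex.conj_conj]
        field_simp
        ring
      rw [hU, e1, one_add_normSq_sphereRot hz, norm_div, norm_neg, norm_div, norm_onePlus]
      congr 1
      rw [norm_neg, norm_inv, RCLike.norm_conj]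
      generalize ‖z + (starRingEnd ℂ) (-((starRingEnd ℂ) w)⁻¹)‖ = d at h0' ⊢
      field_simp
      ring
  · right
    refine ⟨0, fun z hz => ?_⟩
    have hz0 : z ≠ 0 := by simpa using hz
    have hz' : ‖z‖ ≠ 0 := norm_ne_zero_iff.2 hz0
    rw [uSq, hf, norm_mul, hθ, one_mul, norm_pow, ← pow_mul, mul_comm n 2, pow_mul, ← div_pow,
      one_add_normSq_sphereRot hz]
    congr 1
    simp only [sphereRot, map_zero, add_zero, zero_mul, zero_sub, norm_div, norm_neg, norm_one,
      norm_zero]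
    field_simp
    ring

lemma one_sub_muSq_of_mem_polyOpt {n : ℕ} (hn : 1 ≤ n) {f : Polynomial ℂ} (hf : f ∈ polyOpt n)
    {s : ℝ} (hs : 0 < s) (hpos : 0 < muSq n f s) : 1 - muSq n f s = s ^ (n : ℝ)⁻¹ := by
  have h := muSq_of_mem_polyOpt hf s
  have hs1 : s < 1 := by
    by_contra hs1
    have : {z : ℂ | s < ((1 + ‖z‖ ^ 2)⁻¹) ^ n} = ∅ := by
      refine Set.eq_empty_of_forall_notMem fun z hz => ?_
      have h1 : ((1 + ‖z‖ ^ 2)⁻¹) ^ n ≤ 1 :=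
        pow_le_one₀ (by positivity) (inv_le_one_of_one_le₀ (by nlinarith [sq_nonneg ‖z‖]))
      exact hs1 (lt_of_lt_of_le hz h1)
    rw [this, setIntegral_empty] at h
    exact hpos.ne' h
  rw [h, setIntegral_sphereDensity_inv_pow hn hs hs1, sub_sub_cancel]

lemma rpow_neg_two_div_mul_sq_rpow (n : ℕ) {κ : ℝ} (hκ : 0 < κ) :
    κ ^ (-2 / (n : ℝ)) * (κ ^ 2) ^ (n : ℝ)⁻¹ = 1 := by
  rw [← Real.rpow_natCast κ 2, ← Real.rpow_mul hκ.le, ← Real.rpow_add hκ]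
  have : -2 / (n : ℝ) + (2 : ℕ) * (n : ℝ)⁻¹ = 0 := by push_cast; ring
  rw [this, Real.rpow_zero]

/-- **Lemma 2.3 (monotonicity lemma), Case 2.** For an integer `n ≥ 1` and a polynomial
`f` of degree `≤ n`, the function `κ ↦ κ^{−2/n} (1 − μ(κ))` is nondecreasing on
`(0, sup u_f)`; if `f ∈ M₂` it is constant there. -/
theorem mono_poly (n : ℕ) (hn : 1 ≤ n) (f : Polynomial ℂ) (hf : f.natDegree ≤ n) :
    MonotoneOn (fun κ : ℝ => κ ^ (-2/(n:ℝ)) * (1 - muPoly n f κ))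
      (Set.Ioo 0 (⨆ z : ℂ, uPoly n f z)) ∧
    (f ∈ polyOpt n →
      ∀ κ₁ ∈ Set.Ioo 0 (⨆ z : ℂ, uPoly n f z), ∀ κ₂ ∈ Set.Ioo 0 (⨆ z : ℂ, uPoly n f z),
        κ₁ ^ (-2/(n:ℝ)) * (1 - muPoly n f κ₁) = κ₂ ^ (-2/(n:ℝ)) * (1 - muPoly n f κ₂)) := by
  constructor
  · intro κ hκ κ' hκ' hle
    rcases hle.eq_or_lt with rfl | hlt
    · exact le_rfl
    have h0 : 0 < κ := hκ.1
    have h0' : 0 < κ' := hκ'.1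
    obtain ⟨g, hg, hgf⟩ := exists_natDegree_lt_muSq_eq hf hn
    have hpos := muSq_sq_pos hκ'
    simp only [muPoly_eq_muSq n f h0.le, muPoly_eq_muSq n f h0'.le, ← hgf] at hpos ⊢
    have key := one_sub_muSq_mul_rpow_le hg (pow_pos h0 2)
      (pow_lt_pow_left₀ hlt h0.le two_ne_zero) hpos
    have e := rpow_neg_two_div_mul_sq_rpow n h0
    have e' := rpow_neg_two_div_mul_sq_rpow n h0'
    rw [Real.div_rpow (by positivity) (by positivity)] at key
    have hp : 0 < (κ ^ 2) ^ (n : ℝ)⁻¹ := by positivity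
    have hp' : 0 < κ' ^ (-2 / (n : ℝ)) := by positivity
    refine le_trans (le_of_eq ?_) (mul_le_mul_of_nonneg_left key hp'.le)
    rw [mul_left_comm, mul_div_assoc', e', mul_comm, eq_one_div_of_mul_eq_one_left e]
  · intro hopt κ₁ h₁ κ₂ h₂
    rw [muPoly_eq_muSq n f h₁.1.le, muPoly_eq_muSq n f h₂.1.le,
      one_sub_muSq_of_mem_polyOpt hn hopt (pow_pos h₁.1 2) (muSq_sq_pos h₁),
      one_sub_muSq_of_mem_polyOpt hn hopt (pow_pos h₂.1 2) (muSq_sq_pos h₂),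
      rpow_neg_two_div_mul_sq_rpow n h₁.1, rpow_neg_two_div_mul_sq_rpow n h₂.1]
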